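/- arXiv:2605.23884 — 2 statements merged into one kernel-verified Lean document; each statement's English description precedes it below -/
import Mathlib

section
/- Let T ∈ 𝒮′(ℝ^d) be a tempered distribution such that T̂ agrees with a tempered measure μ. Assume T*f ∈ SAP(ℝ^d) for some fixed Schwartz function f. Then f̂·μ is a pure-point measure, the Fourier–Bohr coefficients of T*f satisfy a_k(T*f) = f̂(k) · μ({k}) for all k ∈ ℝ^d, and Σ_{k∈ℝ^d} |f̂(k) μ({k})|² < ∞. -/
set_option linter.unusedSectionVars false

open MeasureTheory Filter Metric Complex SchwartzMap
open scoped Topology ENNReal NNReal ComplexConjugate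

noncomputable section

section Preamble

variable {E : Type*} [NormedAddCommGroup E] [InnerProductSpace ℝ E] [FiniteDimensional ℝ E]
  [MeasurableSpace E] [BorelSpace E]

/-- A set is relatively dense if it has bounded gaps. -/
def IsRelativelyDense (A : Set E) : Prop :=
  ∃ r : ℝ, ∀ x : E, ∃ a ∈ A, dist x a ≤ r

/-- Bohr almost periodic functions: uniformly continuous, bounded, with relatively
dense sets of ε-almost periods. -/
def IsBohrAP (f : E → ℂ) : Prop :=
  UniformContinuous f ∧ (∃ C : ℝ, ∀ x, ‖f x‖ ≤ C) ∧
    ∀ ε : ℝ, 0 < ε → IsRelativelyDense {t : E | ∀ x, ‖f (x - t) - f x‖ < ε}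

/-- Bounded functions. -/
def IsBddFun (f : E → ℂ) : Prop := ∃ C : ℝ, ∀ x, ‖f x‖ ≤ C

lemma isometry_const_sub (x : E) : Isometry (fun y : E => x - y) :=
  Isometry.of_dist_eq (fun a b => dist_sub_left x a b)

lemma hasTemperateGrowth_const_sub (x : E) :
    Function.HasTemperateGrowth (fun y : E => x - y) := by
  apply Function.HasTemperateGrowth.of_fderiv (k := 1) (C := ‖x‖ + 1)
  · have h : (fderiv ℝ (fun y : E => x - y)) =
        fun _ : E => ((0 : E →L[ℝ] E) - ContinuousLinearMap.id ℝ E) := by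
      funext y
      exact ((hasFDerivAt_const x y).sub (hasFDerivAt_id y)).fderiv
    rw [h]
    exact Function.HasTemperateGrowth.const _
  · exact (differentiable_const x).sub differentiable_id
  · intro y
    have h1 : ‖x - y‖ ≤ ‖x‖ + ‖y‖ := norm_sub_le x y
    have h2 : (0:ℝ) ≤ ‖x‖ := norm_nonneg x
    have h3 : (0:ℝ) ≤ ‖y‖ := norm_nonneg y
    calc ‖x - y‖ ≤ ‖x‖ + ‖y‖ := h1
      _ ≤ (‖x‖ + 1) * (1 + ‖y‖) ^ 1 := by nlinarith

/-- The reflected translate `y ↦ ψ (x - y)` of a Schwartz function. -/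
def transRefl (x : E) (ψ : SchwartzMap E ℂ) : SchwartzMap E ℂ :=
  SchwartzMap.compCLMOfAntilipschitz (K := 1) ℝ (hasTemperateGrowth_const_sub x)
    (isometry_const_sub x).antilipschitz ψ

@[simp] lemma transRefl_apply (x : E) (ψ : SchwartzMap E ℂ) (y : E) :
    transRefl x ψ y = ψ (x - y) := rfl

/-- Convolution of a tempered distribution with a Schwartz function:
`(T * ψ)(x) = T (ψ (x - ·))`. -/
def convTD (T : SchwartzMap E ℂ →L[ℂ] ℂ) (ψ : SchwartzMap E ℂ) : E → ℂ :=
  fun x => T (transRefl x ψ)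

/-- Smooth compactly supported test function, regarded inside the Schwartz space. -/
def IsTestFn (φ : SchwartzMap E ℂ) : Prop := HasCompactSupport ⇑φ

/-- Translation bounded as a tempered distribution. -/
def TransBddTD (T : SchwartzMap E ℂ →L[ℂ] ℂ) : Prop :=
  ∀ ψ : SchwartzMap E ℂ, IsBddFun (convTD T ψ)

/-- Translation bounded as a distribution. -/
def TransBddD (T : SchwartzMap E ℂ →L[ℂ] ℂ) : Prop :=
  ∀ ψ : SchwartzMap E ℂ, IsTestFn ψ → IsBddFun (convTD T ψ)

/-- Strongly almost periodic as a tempered distribution. -/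
def SAPTD (T : SchwartzMap E ℂ →L[ℂ] ℂ) : Prop :=
  ∀ ψ : SchwartzMap E ℂ, IsBohrAP (convTD T ψ)

/-- Strongly almost periodic as a distribution. -/
def SAPD (T : SchwartzMap E ℂ →L[ℂ] ℂ) : Prop :=
  ∀ ψ : SchwartzMap E ℂ, IsTestFn ψ → IsBohrAP (convTD T ψ)

/-- The distributional Fourier transform, `T̂(φ) = T(φ̂)`, with the convention
`φ̂(ξ) = ∫ e^{-2πi⟨x,ξ⟩} φ(x) dx`. -/
def fourierTD (T : SchwartzMap E ℂ →L[ℂ] ℂ) : SchwartzMap E ℂ →L[ℂ] ℂ :=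
  T.comp (SchwartzMap.fourierTransformCLM ℂ)

/-- A complex Radon measure, encoded by its total variation measure together with a
unimodular density (polar decomposition). -/
structure CMeasure (E : Type*) [TopologicalSpace E] [MeasurableSpace E] where
  /-- the total variation measure -/
  tv : Measure E
  locFin : IsLocallyFiniteMeasure tv
  /-- the unimodular density -/
  density : E → ℂ
  density_meas : Measurable density
  density_norm : ∀ᵐ x ∂tv, ‖density x‖ = 1

namespace CMeasure

/-- Pairing of a complex measure with a function: `μ(φ) = ∫ φ dμ`. -/
def pairing (μ : CMeasure E) (φ : E → ℂ) : ℂ := ∫ x, φ x * μ.density x ∂μ.tv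

/-- The complex measure agrees with the tempered distribution `T` on all smooth
compactly supported test functions; i.e. `μ` is a tempered measure identified with `T`. -/
def Agrees (μ : CMeasure E) (T : SchwartzMap E ℂ →L[ℂ] ℂ) : Prop :=
  ∀ φ : SchwartzMap E ℂ, IsTestFn φ → T φ = μ.pairing ⇑φ

/-- A tempered measure is one that extends to a tempered distribution. -/
def IsTempered (μ : CMeasure E) : Prop := ∃ T, μ.Agrees T

/-- Pure point measure: concentrated on a countable set. -/
def IsPurePoint (μ : CMeasure E) : Prop := ∃ S : Set E, S.Countable ∧ μ.tv Sᶜ = 0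

/-- Convolution of a complex measure with a function: `(μ * φ)(x) = ∫ φ(x - y) dμ(y)`. -/
def convM (μ : CMeasure E) (φ : E → ℂ) : E → ℂ :=
  fun x => ∫ y, φ (x - y) * μ.density y ∂μ.tv

/-- Translation bounded as a measure. -/
def TransBddM (μ : CMeasure E) : Prop :=
  ∀ φ : E → ℂ, Continuous φ → HasCompactSupport φ → IsBddFun (μ.convM φ)

/-- Strongly almost periodic as a measure. -/
def SAPM (μ : CMeasure E) : Prop :=
  ∀ φ : E → ℂ, Continuous φ → HasCompactSupport φ → IsBohrAP (μ.convM φ)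

/-- Strongly tempered measure: the total variation has polynomial growth,
equivalently `|μ|` is a tempered (slowly increasing) measure. -/
def IsStronglyTempered (μ : CMeasure E) : Prop :=
  ∃ C a : ℝ, ∀ r : ℝ, 1 ≤ r → μ.tv (Metric.closedBall 0 r) ≤ ENNReal.ofReal (C * r ^ a)

/-- The atom of a complex measure at a point: `μ({x})`. -/
def atom (μ : CMeasure E) (x : E) : ℂ := (μ.tv {x}).toReal • μ.density x

/-- The measure is concentrated on a locally finite set. -/
def LocallyFiniteSupport (μ : CMeasure E) : Prop :=
  ∃ S : Set E, (∀ K : Set E, IsCompact K → (S ∩ K).Finite) ∧ μ.tv Sᶜ = 0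

end CMeasure

end Preamble

section Mean

variable {d : ℕ}

/-- The centred cube `[-R, R]^d`. -/
def cube (d : ℕ) (R : ℝ) : Set (EuclideanSpace ℝ (Fin d)) :=
  {x : EuclideanSpace ℝ (Fin d) | ∀ i, |x i| ≤ R}

/-- `g` has mean `m`: the averages over the cubes `[-R, R]^d` converge to `m`. -/
def HasMean (g : EuclideanSpace ℝ (Fin d) → ℂ) (m : ℂ) : Prop :=
  Filter.Tendsto (fun R : ℝ => ((2 * R) ^ d)⁻¹ • ∫ x in cube d R, g x)
    Filter.atTop (nhds m)

/-- The character `x ↦ e^{-2πi⟨x,k⟩}`. -/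
def eChar (k x : EuclideanSpace ℝ (Fin d)) : ℂ :=
  Complex.exp (((-(2 * Real.pi * (inner ℝ x k : ℝ)) : ℝ) : ℂ) * Complex.I)

end Mean

set_option linter.style.longLine false

open scoped FourierTransform

section Part1

variable {V : Type*} [NormedAddCommGroup V] [InnerProductSpace ℝ V] [FiniteDimensional ℝ V]
  [MeasurableSpace V] [BorelSpace V]

/-- Compactly supported smooth functions are sequentially dense in the Schwartz space. -/
lemma exists_testFn_seq (h : SchwartzMap V ℂ) :
    ∃ φ : ℕ → SchwartzMap V ℂ, (∀ n, HasCompactSupport (φ n)) ∧ Tendsto φ atTop (𝓝 h) := by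
  let b : ContDiffBump (0 : V) := ⟨1, 2, one_pos, one_lt_two⟩
  let χ : V → ℂ := fun x => ((b x : ℝ) : ℂ)
  have hχ : ContDiff ℝ (⊤ : ℕ∞) χ := Complex.ofRealCLM.contDiff.comp b.contDiff
  have hχc : HasCompactSupport χ := by
    have := b.hasCompactSupport
    exact this.comp_left (g := fun r : ℝ => (r : ℂ)) (by simp)
  let a : ℕ → ℝ := fun n => ((n : ℝ) + 1)⁻¹
  have ha0 : ∀ n, 0 < a n := fun n => by positivity
  have ha1 : ∀ n, a n ≤ 1 := fun n => by
    apply inv_le_one_of_one_le₀; have : (0:ℝ) ≤ n := by positivity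
    linarith
  have hsm : ∀ n, ContDiff ℝ (⊤ : ℕ∞) (fun x : V => χ (a n • x)) := fun n =>
    hχ.comp (contDiff_const_smul _)
  have hprod : ∀ n, ContDiff ℝ (⊤ : ℕ∞) (fun x : V => χ (a n • x) * h x) := fun n =>
    (hsm n).mul (h.smooth ⊤)
  have hcs : ∀ n, HasCompactSupport (fun x : V => χ (a n • x) * h x) := fun n =>
    (hχc.comp_smul (ha0 n).ne').mul_right
  refine ⟨fun n => (hcs n).toSchwartzMap (hprod n), fun n => hcs n, ?_⟩
  rw [(schwartz_withSeminorms ℝ V ℂ).tendsto_nhds]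
  rintro ⟨k, m⟩ ε hε
  -- bounds for the derivatives of `χ - 1`
  have hCb : ∀ i : ℕ, ∃ C : ℝ, 0 ≤ C ∧ ∀ x, ‖iteratedFDeriv ℝ i (fun x => χ x - 1) x‖ ≤ C := by
    intro i
    obtain ⟨C, hC⟩ := (hχc.iteratedFDeriv (𝕜 := ℝ) i).exists_bound_of_continuous
      ((hχ.of_le (mod_cast le_top)).continuous_iteratedFDeriv' (m := i))
    have hC0 : 0 ≤ C := (norm_nonneg _).trans (hC 0)
    refine ⟨C + 1, by linarith, fun x => ?_⟩
    have h1 : iteratedFDeriv ℝ i (fun x => χ x - 1) x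
        = iteratedFDeriv ℝ i χ x - iteratedFDeriv ℝ i (fun _ : V => (1:ℂ)) x := by
      exact iteratedFDeriv_sub_apply (f := χ) (g := fun _ => (1:ℂ))
        ((hχ.of_le (mod_cast le_top)).contDiffAt) contDiff_const.contDiffAt
    rw [h1]
    refine (norm_sub_le _ _).trans (add_le_add (hC x) ?_)
    rcases Nat.eq_zero_or_pos i with rfl | hi
    · simp
    · rw [iteratedFDeriv_const_of_ne hi.ne']; simp
  choose C hC0 hC using hCb
  have hun : ∀ n, ∀ i : ℕ, ∀ x, ‖iteratedFDeriv ℝ i (fun x => χ (a n • x) - 1) x‖ ≤ C i := by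
    intro n i x
    rw [iteratedFDeriv_comp_const_smul (f := fun x => χ x - 1) (a n)
      ((hχ.of_le (mod_cast le_top)).sub contDiff_const)]
    rw [norm_smul]
    have : ‖a n ^ i‖ ≤ 1 := by
      rw [norm_pow, Real.norm_of_nonneg (ha0 n).le]; exact pow_le_one₀ (ha0 n).le (ha1 n)
    calc _ ≤ 1 * C i := mul_le_mul this (hC i _) (norm_nonneg _) zero_le_one
      _ = C i := one_mul _
  let M : ℝ := ∑ i ∈ Finset.range (m + 1), (m.choose i) * C i * SchwartzMap.seminorm ℝ (k+1) (m - i) h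
  have hM0 : 0 ≤ M := Finset.sum_nonneg fun i _ => by
    have := hC0 i
    have := apply_nonneg (SchwartzMap.seminorm ℝ (k+1) (m - i)) h
    positivity
  have key : ∀ n, schwartzSeminormFamily ℝ V ℂ (k, m) ((hcs n).toSchwartzMap (hprod n) - h) ≤ a n * M := by
    intro n
    rw [SchwartzMap.schwartzSeminormFamily_apply]
    have hcoe : (⇑((hcs n).toSchwartzMap (hprod n) - h) : V → ℂ)
        = fun x => (χ (a n • x) - 1) * h x := by
      funext x
      change χ (a n • x) * h x - h x = _
      ring
    apply SchwartzMap.seminorm_le_bound _ _ _ _ (mul_nonneg (ha0 n).le hM0)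
    intro x
    rw [hcoe]
    by_cases hx : ‖a n • x‖ < 1
    · have : (fun x => (χ (a n • x) - 1) * h x) =ᶠ[𝓝 x] fun _ => 0 := by
        have hopen : IsOpen {x : V | ‖a n • x‖ < 1} :=
          isOpen_lt (by fun_prop) continuous_const
        filter_upwards [hopen.mem_nhds hx] with y hy
        have : b (a n • y) = 1 := b.one_of_mem_closedBall (by
          simpa [b] using le_of_lt hy)
        simp [χ, this]
      rw [(this.iteratedFDeriv ℝ m).eq_of_nhds]
      have : iteratedFDeriv ℝ m (fun _ : V => (0:ℂ)) x = 0 := by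
        have := iteratedFDeriv_fun_zero (𝕜 := ℝ) (E := V) (F := ℂ) (n := m)
        rw [this]; rfl
      rw [this]
      simpa using mul_nonneg (ha0 n).le hM0
    · have hx' : 1 ≤ a n * ‖x‖ := by
        rw [norm_smul, Real.norm_of_nonneg (ha0 n).le] at hx; linarith
      have hL := norm_iteratedFDeriv_mul_le (𝕜 := ℝ) (N := (⊤ : ℕ∞)) ((hsm n).sub contDiff_const)
        (h.smooth ⊤) x (n := m) (mod_cast le_top) (f := fun x => χ (a n • x) - 1)
      calc _ ≤ ‖x‖ ^ k * ∑ i ∈ Finset.range (m + 1), (m.choose i) *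
              ‖iteratedFDeriv ℝ i (fun x => χ (a n • x) - 1) x‖ * ‖iteratedFDeriv ℝ (m - i) h x‖ := by
            gcongr
        _ ≤ (a n * ‖x‖) * (‖x‖ ^ k * ∑ i ∈ Finset.range (m + 1), (m.choose i) *
              C i * ‖iteratedFDeriv ℝ (m - i) h x‖) := by
            have h0 : 0 ≤ ‖x‖ ^ k * ∑ i ∈ Finset.range (m + 1), (m.choose i) *
              C i * ‖iteratedFDeriv ℝ (m - i) h x‖ := by
              apply mul_nonneg (by positivity)
              exact Finset.sum_nonneg fun i _ => by have := hC0 i; positivity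
            refine le_trans ?_ (le_mul_of_one_le_left h0 hx')
            gcongr with i _
            exact hun n i x
        _ = a n * ∑ i ∈ Finset.range (m + 1), (m.choose i) *
              C i * (‖x‖ ^ (k+1) * ‖iteratedFDeriv ℝ (m - i) h x‖) := by
            rw [mul_assoc, Finset.mul_sum, Finset.mul_sum, Finset.mul_sum, Finset.mul_sum]
            refine Finset.sum_congr rfl fun i _ => ?_
            ring
        _ ≤ a n * M := by
            refine mul_le_mul_of_nonneg_left ?_ (ha0 n).le
            refine Finset.sum_le_sum fun i _ => ?_
            have := hC0 i
            exact mul_le_mul_of_nonneg_left (SchwartzMap.le_seminorm ℝ _ _ h x) (by positivity)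
  have hlim : Tendsto (fun n => a n * M) atTop (𝓝 0) := by
    have : Tendsto a atTop (𝓝 0) := by
      simpa [a, one_div] using tendsto_one_div_add_atTop_nhds_zero_nat (𝕜 := ℝ)
    simpa using this.mul_const M
  filter_upwards [hlim.eventually (gt_mem_nhds hε)] with n hn
  exact (key n).trans_lt hn

lemma transRefl_seminorm_bound (k n : ℕ) (x : V) (f : SchwartzMap V ℂ) :
    SchwartzMap.seminorm ℂ k n (transRefl x f) ≤
      (1 + ‖x‖) ^ k * (2 ^ k * ((Finset.Iic (k, n)).sup (schwartzSeminormFamily ℂ V ℂ)) f) := by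
  have h0 : 0 ≤ ((Finset.Iic (k, n)).sup (schwartzSeminormFamily ℂ V ℂ)) f := apply_nonneg _ _
  apply SchwartzMap.seminorm_le_bound _ _ _ _ (by positivity)
  intro y
  have h1 : ‖iteratedFDeriv ℝ n (transRefl x f) y‖ = ‖iteratedFDeriv ℝ n f (x - y)‖ := by
    have e1 : (⇑(transRefl x f) : V → ℂ) = (fun z => f (x + z)) ∘ (LinearIsometryEquiv.neg ℝ (E := V)) := by
      funext z; simp [sub_eq_add_neg]
    rw [e1, LinearIsometryEquiv.norm_iteratedFDeriv_comp_right, iteratedFDeriv_comp_add_left]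
    simp [sub_eq_add_neg]
  rw [h1]
  have h2 := SchwartzMap.one_add_le_sup_seminorm_apply (𝕜 := ℂ) (m := (k, n)) le_rfl le_rfl f (x - y)
  have h3 : ‖y‖ ≤ (1 + ‖x‖) * (1 + ‖x - y‖) := by
    have : ‖y‖ ≤ ‖x‖ + ‖x - y‖ := by
      calc ‖y‖ = ‖x - (x - y)‖ := by simp
        _ ≤ _ := norm_sub_le _ _
    nlinarith [norm_nonneg x, norm_nonneg (x - y)]
  calc _ ≤ ((1 + ‖x‖) * (1 + ‖x - y‖)) ^ k * ‖iteratedFDeriv ℝ n f (x - y)‖ := by gcongr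
    _ = (1 + ‖x‖) ^ k * ((1 + ‖x - y‖) ^ k * ‖iteratedFDeriv ℝ n f (x - y)‖) := by rw [mul_pow]; ring
    _ ≤ _ := mul_le_mul_of_nonneg_left h2 (by positivity)

/-- Polynomial growth of `T * f`, uniformly along convergent sequences. -/
lemma convTD_bound_seq (T : SchwartzMap V ℂ →L[ℂ] ℂ) (f : SchwartzMap V ℂ)
    (φ : ℕ → SchwartzMap V ℂ) (hφ : Tendsto φ atTop (𝓝 f)) :
    ∃ (C : ℝ) (N : ℕ), ∀ n x, ‖convTD T (φ n) x‖ ≤ C * (1 + ‖x‖) ^ N := by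
  let q : Seminorm ℂ (SchwartzMap V ℂ) := (normSeminorm ℂ ℂ).comp T.toLinearMap
  have hq : Continuous q := by
    change Continuous fun f => ‖T f‖
    exact T.continuous.norm
  obtain ⟨s, C, -, hC⟩ := Seminorm.bound_of_continuous (schwartz_withSeminorms ℂ V ℂ) q hq
  let N := s.sup Prod.fst
  have hbd : ∀ i : ℕ × ℕ, ∃ B : ℝ, 0 ≤ B ∧ ∀ n, ((Finset.Iic i).sup (schwartzSeminormFamily ℂ V ℂ)) (φ n) ≤ B := by
    intro i
    have hc : Continuous ⇑((Finset.Iic i).sup (schwartzSeminormFamily ℂ V ℂ) : Seminorm ℂ (SchwartzMap V ℂ)) :=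
      (schwartz_withSeminorms ℂ V ℂ).finset_sups.continuous_seminorm (Finset.Iic i)
    have := (hc.tendsto f).comp hφ
    obtain ⟨B, hB⟩ := this.bddAbove_range
    refine ⟨B, (apply_nonneg _ (φ 0)).trans (hB ⟨0, rfl⟩), fun n => hB ⟨n, rfl⟩⟩
  choose B hB0 hB using hbd
  let D : ℝ := ∑ i ∈ s, 2 ^ i.1 * B i
  have hD0 : ∀ i, 0 ≤ 2 ^ i.1 * B i := fun i => mul_nonneg (by positivity) (hB0 i)
  refine ⟨C * D, N, fun n x => ?_⟩
  have h1 : ‖convTD T (φ n) x‖ ≤ C * (s.sup (schwartzSeminormFamily ℂ V ℂ)) (transRefl x (φ n)) :=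
    hC (transRefl x (φ n))
  refine h1.trans ?_
  rw [mul_assoc]
  refine mul_le_mul_of_nonneg_left ?_ C.2
  apply Seminorm.finset_sup_apply_le
  · exact mul_nonneg (Finset.sum_nonneg fun i _ => hD0 i) (by positivity)
  · rintro ⟨k, m⟩ hi
    refine (transRefl_seminorm_bound k m x (φ n)).trans ?_
    rw [mul_comm]
    apply mul_le_mul
    · refine le_trans ?_ (Finset.single_le_sum (fun i _ => hD0 i) hi)
      exact mul_le_mul_of_nonneg_left (hB (k, m) n) (by positivity)
    · apply pow_le_pow_right₀
      · linarith [norm_nonneg x]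
      · exact Finset.le_sup (f := Prod.fst) hi
    · positivity
    · exact Finset.sum_nonneg fun i _ => hD0 i

end Part1

section Part2

variable {d : ℕ}


lemma eChar_comm (k x : (EuclideanSpace ℝ (Fin d))) : eChar k x = eChar x k := by
  unfold eChar; rw [real_inner_comm]

@[simp] lemma eChar_norm (k x : (EuclideanSpace ℝ (Fin d))) : ‖eChar k x‖ = 1 := by
  unfold eChar; exact Complex.norm_exp_ofReal_mul_I _

lemma eChar_add_right (k x y : (EuclideanSpace ℝ (Fin d))) : eChar k (x + y) = eChar k x * eChar k y := by
  unfold eChar; rw [← Complex.exp_add, inner_add_left]; congr 1; push_cast; ring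

lemma eChar_add_left (k l x : (EuclideanSpace ℝ (Fin d))) : eChar (k + l) x = eChar k x * eChar l x := by
  rw [eChar_comm, eChar_add_right, eChar_comm x k, eChar_comm x l]

@[simp] lemma eChar_zero_right (k : (EuclideanSpace ℝ (Fin d))) : eChar k 0 = 1 := by
  unfold eChar; simp

@[simp] lemma eChar_zero_left (k : (EuclideanSpace ℝ (Fin d))) : eChar 0 k = 1 := by
  unfold eChar; simp

lemma eChar_neg_left (k x : (EuclideanSpace ℝ (Fin d))) : eChar (-k) x = eChar k (-x) := by
  unfold eChar; rw [inner_neg_left, inner_neg_right]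

lemma eChar_conj (k x : (EuclideanSpace ℝ (Fin d))) : conj (eChar k x) = eChar k (-x) := by
  unfold eChar
  rw [← Complex.exp_conj, map_mul, Complex.conj_ofReal, Complex.conj_I, inner_neg_left]
  congr 1; push_cast; ring

lemma eChar_mul_neg (k x : (EuclideanSpace ℝ (Fin d))) : eChar k x * eChar k (-x) = 1 := by
  rw [← eChar_add_right]; simp

lemma eChar_smul (r : ℝ) (k x : (EuclideanSpace ℝ (Fin d))) : eChar (r • k) x = eChar k (r • x) := by
  unfold eChar; rw [inner_smul_left, inner_smul_right]; simp

lemma continuous_eChar : Continuous fun p : (EuclideanSpace ℝ (Fin d)) × (EuclideanSpace ℝ (Fin d)) => eChar p.1 p.2 := by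
  unfold eChar; fun_prop

@[fun_prop]
lemma Continuous.eChar' {X : Type*} [TopologicalSpace X] {a b : X → (EuclideanSpace ℝ (Fin d))} (ha : Continuous a)
    (hb : Continuous b) : Continuous fun x => eChar (a x) (b x) :=
  continuous_eChar.comp (ha.prodMk hb)

lemma fourier_eq_eChar (ψ : SchwartzMap (EuclideanSpace ℝ (Fin d)) ℂ) (x : (EuclideanSpace ℝ (Fin d))) : 𝓕 ψ x = ∫ v, eChar x v * ψ v := by
  rw [SchwartzMap.fourier_coe, Real.fourier_eq']
  refine integral_congr_ae (Eventually.of_forall fun v => ?_)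
  simp only [eChar, smul_eq_mul]
  congr 3
  push_cast; ring

lemma fourierInv_eq_eChar (ψ : SchwartzMap (EuclideanSpace ℝ (Fin d)) ℂ) (x : (EuclideanSpace ℝ (Fin d))) : 𝓕⁻ ψ x = ∫ v, eChar x (-v) * ψ v := by
  rw [SchwartzMap.fourierInv_coe, Real.fourierInv_eq']
  refine integral_congr_ae (Eventually.of_forall fun v => ?_)
  simp only [eChar, smul_eq_mul, inner_neg_left]
  congr 3
  push_cast; ring

/-- The (inverse) Fourier transform of the complex measure `F λ`. -/
def ftm (ν : Measure (EuclideanSpace ℝ (Fin d))) (F : (EuclideanSpace ℝ (Fin d)) → ℂ) (x : (EuclideanSpace ℝ (Fin d))) : ℂ := ∫ ξ, eChar ξ (-x) * F ξ ∂ν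

/-- The distributional Fourier transform of `g` agrees with `F λ` on test functions. -/
def FRel (g : (EuclideanSpace ℝ (Fin d)) → ℂ) (ν : Measure (EuclideanSpace ℝ (Fin d))) (F : (EuclideanSpace ℝ (Fin d)) → ℂ) : Prop :=
  ∀ ψ : SchwartzMap (EuclideanSpace ℝ (Fin d)) ℂ, HasCompactSupport ψ → ∫ x, g x * 𝓕 ψ x = ∫ ξ, ψ ξ * F ξ ∂ν

lemma integrable_eChar_mul {ν : Measure (EuclideanSpace ℝ (Fin d))} {F : (EuclideanSpace ℝ (Fin d)) → ℂ} (hF : Integrable F ν) (x : (EuclideanSpace ℝ (Fin d))) :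
    Integrable (fun ξ => eChar ξ x * F ξ) ν :=
  hF.bdd_mul (c := 1) (by fun_prop : Continuous fun ξ : (EuclideanSpace ℝ (Fin d)) => eChar ξ x).aestronglyMeasurable
    (Eventually.of_forall fun ξ => by simp)

lemma ftm_norm_le {ν : Measure (EuclideanSpace ℝ (Fin d))} {F : (EuclideanSpace ℝ (Fin d)) → ℂ} (x : (EuclideanSpace ℝ (Fin d))) : ‖ftm ν F x‖ ≤ ∫ ξ, ‖F ξ‖ ∂ν := by
  refine (norm_integral_le_integral_norm _).trans (le_of_eq ?_)
  simp

lemma continuous_ftm {ν : Measure (EuclideanSpace ℝ (Fin d))} {F : (EuclideanSpace ℝ (Fin d)) → ℂ} (hF : Integrable F ν) :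
    Continuous (ftm ν F) := by
  unfold ftm
  refine continuous_of_dominated (bound := fun ξ => ‖F ξ‖) ?_ ?_ hF.norm ?_
  · exact fun x => (integrable_eChar_mul hF _).aestronglyMeasurable
  · exact fun x => Eventually.of_forall fun ξ => by simp
  · exact Eventually.of_forall fun ξ => by fun_prop

lemma frel_ftm {ν : Measure (EuclideanSpace ℝ (Fin d))} [SFinite ν] {F : (EuclideanSpace ℝ (Fin d)) → ℂ} (hF : Integrable F ν)
    (ψ : SchwartzMap (EuclideanSpace ℝ (Fin d)) ℂ) : ∫ x, ftm ν F x * 𝓕 ψ x = ∫ ξ, ψ ξ * F ξ ∂ν := by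
  have h1 : ∀ x, ftm ν F x * 𝓕 ψ x = ∫ ξ, eChar ξ (-x) * (𝓕 ψ x * F ξ) ∂ν := by
    intro x
    unfold ftm
    rw [← integral_mul_const]
    refine integral_congr_ae (Eventually.of_forall fun v => ?_)
    ring
  simp_rw [h1]
  rw [integral_integral_swap]
  · refine integral_congr_ae (Eventually.of_forall fun ξ => ?_)
    have h2 : ψ ξ = 𝓕⁻ (𝓕 ψ) ξ := by rw [FourierTransform.fourierInv_fourier_eq]
    rw [fourierInv_eq_eChar] at h2
    dsimp only
    rw [h2, ← integral_mul_const]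
    refine integral_congr_ae (Eventually.of_forall fun v => ?_)
    ring
  · have h3 : Integrable (fun p : (EuclideanSpace ℝ (Fin d)) × (EuclideanSpace ℝ (Fin d)) => 𝓕 ψ p.1 * F p.2) (volume.prod ν) :=
      (𝓕 ψ).integrable.mul_prod hF
    exact h3.bdd_mul (c := 1)
      (by fun_prop : Continuous fun p : (EuclideanSpace ℝ (Fin d)) × (EuclideanSpace ℝ (Fin d)) => eChar p.2 (-p.1)).aestronglyMeasurable
      (Eventually.of_forall fun ξ => by simp)

lemma fourierInv_transRefl (x : (EuclideanSpace ℝ (Fin d))) (f : SchwartzMap (EuclideanSpace ℝ (Fin d)) ℂ) (ξ : (EuclideanSpace ℝ (Fin d))) :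
    𝓕⁻ (transRefl x f) ξ = eChar ξ (-x) * 𝓕 f ξ := by
  rw [fourierInv_eq_eChar, fourier_eq_eChar, ← integral_const_mul,
    ← integral_sub_left_eq_self _ volume x]
  refine integral_congr_ae (Eventually.of_forall fun v => ?_)
  simp only [transRefl_apply, sub_sub_cancel]
  rw [← mul_assoc, ← eChar_add_right]
  congr 2
  abel

variable {T : SchwartzMap (EuclideanSpace ℝ (Fin d)) ℂ →L[ℂ] ℂ} {μ : CMeasure (EuclideanSpace ℝ (Fin d))}

lemma convTD_eq_ftm (hAg : μ.Agrees (fourierTD T)) (f : SchwartzMap (EuclideanSpace ℝ (Fin d)) ℂ)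
    (hf : HasCompactSupport ⇑(𝓕 f : SchwartzMap (EuclideanSpace ℝ (Fin d)) ℂ)) (x : (EuclideanSpace ℝ (Fin d))) :
    convTD T f x = ftm μ.tv (fun ξ => 𝓕 f ξ * μ.density ξ) x := by
  have hc : HasCompactSupport ⇑(𝓕⁻ (transRefl x f) : SchwartzMap (EuclideanSpace ℝ (Fin d)) ℂ) := by
    have : (⇑(𝓕⁻ (transRefl x f) : SchwartzMap (EuclideanSpace ℝ (Fin d)) ℂ) : (EuclideanSpace ℝ (Fin d)) → ℂ) = fun ξ => eChar ξ (-x) * 𝓕 f ξ := by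
      funext ξ; exact fourierInv_transRefl x f ξ
    rw [this]
    exact hf.mul_left
  have := hAg _ hc
  unfold fourierTD at this
  rw [ContinuousLinearMap.comp_apply, SchwartzMap.fourierTransformCLM_apply,
    FourierTransform.fourier_fourierInv_eq] at this
  unfold convTD ftm
  rw [this]
  unfold CMeasure.pairing
  refine integral_congr_ae (Eventually.of_forall fun ξ => ?_)
  dsimp only
  rw [fourierInv_transRefl, mul_assoc]

lemma density_locInt (μ : CMeasure (EuclideanSpace ℝ (Fin d))) (h : (EuclideanSpace ℝ (Fin d)) → ℂ) (hh : Continuous h) :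
    LocallyIntegrable (fun ξ => h ξ * μ.density ξ) μ.tv := by
  have := μ.locFin
  have : LocallyIntegrable h μ.tv := hh.locallyIntegrable
  rw [locallyIntegrable_iff] at this ⊢
  intro K hK
  refine Integrable.mul_bdd (c := 1) (this K hK) μ.density_meas.aestronglyMeasurable ?_
  exact ae_restrict_of_ae (μ.density_norm.mono fun x hx => hx.le)

lemma density_int (μ : CMeasure (EuclideanSpace ℝ (Fin d))) (h : (EuclideanSpace ℝ (Fin d)) → ℂ) (hh : Continuous h) (hc : HasCompactSupport h) :
    Integrable (fun ξ => h ξ * μ.density ξ) μ.tv := by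
  have := μ.locFin
  refine Integrable.mul_bdd (c := 1) (hh.integrable_of_hasCompactSupport hc) μ.density_meas.aestronglyMeasurable ?_
  exact (μ.density_norm.mono fun x hx => hx.le)

lemma schwartz_integrable_poly (ψ : SchwartzMap (EuclideanSpace ℝ (Fin d)) ℂ) (N : ℕ) :
    Integrable (fun x => (1 + ‖x‖) ^ N * ‖ψ x‖) := by
  have h1 : Integrable (fun x => 2 ^ (N - 1) * (‖ψ x‖ + ‖x‖ ^ N * ‖ψ x‖)) :=
    (ψ.integrable.norm.add (ψ.integrable_pow_mul volume N)).const_mul _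
  refine h1.mono' (by fun_prop) (Eventually.of_forall fun x => ?_)
  rw [Real.norm_of_nonneg (by positivity)]
  have := add_pow_le (zero_le_one) (norm_nonneg x) N
  calc (1 + ‖x‖) ^ N * ‖ψ x‖ ≤ (2 ^ (N - 1) * (1 ^ N + ‖x‖ ^ N)) * ‖ψ x‖ := by gcongr
    _ = _ := by ring

lemma frel_convTD (hAg : μ.Agrees (fourierTD T)) (f : SchwartzMap (EuclideanSpace ℝ (Fin d)) ℂ) :
    FRel (convTD T f) μ.tv (fun ξ => 𝓕 f ξ * μ.density ξ) := by
  intro ψ hψ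
  have := μ.locFin
  obtain ⟨φ, hφc, hφ⟩ := exists_testFn_seq (𝓕 f)
  have hF : Tendsto (fun n => 𝓕⁻ (φ n)) atTop (𝓝 f) := by
    have h1 : Continuous fun g : SchwartzMap (EuclideanSpace ℝ (Fin d)) ℂ => 𝓕⁻ g :=
      (FourierTransform.fourierInvCLM ℂ (SchwartzMap (EuclideanSpace ℝ (Fin d)) ℂ)).continuous
    have := (h1.tendsto (𝓕 f)).comp hφ
    rwa [FourierTransform.fourierInv_fourier_eq] at this
  obtain ⟨C, N, hCN⟩ := convTD_bound_seq T f _ hF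
  have hfc : ∀ n, 𝓕 (𝓕⁻ (φ n)) = φ n := fun n => FourierTransform.fourier_fourierInv_eq _
  have heq : ∀ n x, convTD T (𝓕⁻ (φ n)) x = ftm μ.tv (fun ξ => φ n ξ * μ.density ξ) x := by
    intro n x
    rw [convTD_eq_ftm hAg _ (by rw [hfc]; exact hφc n), hfc]
  have hInt : ∀ n, Integrable (fun ξ => φ n ξ * μ.density ξ) μ.tv := fun n =>
    density_int μ _ (φ n).continuous (hφc n)
  have hlim1 : Tendsto (fun n => ∫ x, convTD T (𝓕⁻ (φ n)) x * 𝓕 ψ x) atTop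
      (𝓝 (∫ x, convTD T f x * 𝓕 ψ x)) := by
    refine tendsto_integral_of_dominated_convergence
      (fun x => C * ((1 + ‖x‖) ^ N * ‖𝓕 ψ x‖)) ?_ ((schwartz_integrable_poly _ N).const_mul C) ?_ ?_
    · intro n
      simp_rw [heq n]
      exact ((continuous_ftm (hInt n)).mul (𝓕 ψ).continuous).aestronglyMeasurable
    · intro n
      refine Eventually.of_forall fun x => ?_
      rw [norm_mul, ← mul_assoc]
      exact mul_le_mul_of_nonneg_right (hCN n x) (norm_nonneg _)
    · refine Eventually.of_forall fun x => ?_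
      refine Tendsto.mul_const _ ?_
      have : Continuous fun g : SchwartzMap (EuclideanSpace ℝ (Fin d)) ℂ => convTD T g x := by
        unfold convTD transRefl
        exact T.continuous.comp (ContinuousLinearMap.continuous _)
      exact (this.tendsto f).comp hF
  have hψt := ψ.hasTemperateGrowth
  have hpair : ∀ g : SchwartzMap (EuclideanSpace ℝ (Fin d)) ℂ, fourierTD T (SchwartzMap.smulLeftCLM ℂ ψ g)
      = ∫ ξ, ψ ξ * (g ξ * μ.density ξ) ∂μ.tv := by
    intro g
    have e : (⇑(SchwartzMap.smulLeftCLM ℂ ψ g) : (EuclideanSpace ℝ (Fin d)) → ℂ) = fun ξ => ψ ξ * g ξ := by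
      funext ξ
      rw [SchwartzMap.smulLeftCLM_apply_apply hψt]; rfl
    rw [hAg _ (by unfold IsTestFn; rw [e]; exact hψ.mul_right), e]
    unfold CMeasure.pairing
    simp_rw [mul_assoc]
  have hlim2 : Tendsto (fun n => ∫ x, convTD T (𝓕⁻ (φ n)) x * 𝓕 ψ x) atTop
      (𝓝 (∫ ξ, ψ ξ * (𝓕 f ξ * μ.density ξ) ∂μ.tv)) := by
    rw [← hpair]
    have : ∀ n, ∫ x, convTD T (𝓕⁻ (φ n)) x * 𝓕 ψ x
        = fourierTD T (SchwartzMap.smulLeftCLM ℂ ψ (φ n)) := by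
      intro n
      rw [hpair]
      simp_rw [heq n]
      exact frel_ftm (hInt n) ψ
    simp_rw [this]
    have hc : Continuous fun g => fourierTD T (SchwartzMap.smulLeftCLM ℂ ψ g) :=
      (fourierTD T).continuous.comp (SchwartzMap.smulLeftCLM ℂ ψ).continuous
    exact (hc.tendsto _).comp hφ
  exact tendsto_nhds_unique hlim1 hlim2

end Part2

section Part3

variable {d : ℕ}

lemma exists_testFn_L1_close (u : (EuclideanSpace ℝ (Fin d)) → ℂ) (hu : Integrable u) {ε : ℝ} (hε : 0 < ε) :
    ∃ ψ : SchwartzMap (EuclideanSpace ℝ (Fin d)) ℂ, HasCompactSupport ψ ∧ ∫ x, ‖u x - 𝓕 ψ x‖ < ε := by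
  have hm : MemLp u 1 := memLp_one_iff_integrable.2 hu
  have hd := SchwartzMap.denseRange_toLpCLM (E := (EuclideanSpace ℝ (Fin d))) (F := ℂ) (p := 1) (by simp) (μ := volume)
  obtain ⟨s, hs⟩ := Metric.denseRange_iff.1 hd (hm.toLp u) ε hε
  obtain ⟨φ, hφc, hφ⟩ := exists_testFn_seq (𝓕⁻ s)
  have hF : Tendsto (fun n => 𝓕 (φ n)) atTop (𝓝 s) := by
    have h1 : Continuous fun g : SchwartzMap (EuclideanSpace ℝ (Fin d)) ℂ => 𝓕 g :=
      (FourierTransform.fourierCLM ℂ (SchwartzMap (EuclideanSpace ℝ (Fin d)) ℂ)).continuous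
    have := (h1.tendsto (𝓕⁻ s)).comp hφ
    rwa [FourierTransform.fourier_fourierInv_eq] at this
  have h2 : Tendsto (fun n => dist (hm.toLp u) (SchwartzMap.toLpCLM ℝ ℂ 1 volume (𝓕 (φ n)))) atTop
      (𝓝 (dist (hm.toLp u) (SchwartzMap.toLpCLM ℝ ℂ 1 volume s))) :=
    tendsto_const_nhds.dist (((SchwartzMap.toLpCLM ℝ ℂ 1 volume).continuous.tendsto s).comp hF)
  obtain ⟨n, hn⟩ := (h2.eventually (gt_mem_nhds hs)).exists
  refine ⟨φ n, hφc n, ?_⟩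
  rw [dist_eq_norm, L1.norm_eq_integral_norm] at hn
  refine lt_of_eq_of_lt (integral_congr_ae ?_) hn
  have e1 := hm.coeFn_toLp
  have e2 := (𝓕 (φ n)).coeFn_toLp 1 volume
  have e3 := Lp.coeFn_sub (hm.toLp u) ((𝓕 (φ n)).toLp 1 volume)
  filter_upwards [e1, e2, e3] with x h1 h2 h3
  change _ = ‖(hm.toLp u - (𝓕 (φ n)).toLp 1 volume : Lp ℂ 1 volume) x‖
  rw [h3, Pi.sub_apply, h1, h2]

/-- normalized indicator function of the unit cube -/
def cubeInd (d : ℕ) : (EuclideanSpace ℝ (Fin d)) → ℂ := (cube d 1).indicator fun _ => ((2:ℂ) ^ d)⁻¹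

lemma cube_eq_preimage (R : ℝ) : cube d R =
    ((MeasurableEquiv.toLp 2 (Fin d → ℝ)).symm) ⁻¹' (Set.Icc (fun _ => -R) (fun _ => R)) := by
  ext x
  simp only [cube, Set.mem_ofPred_eq, Set.mem_preimage, Set.mem_Icc, Pi.le_def, abs_le, forall_and]
  rfl

lemma measurableSet_cube (R : ℝ) : MeasurableSet (cube d R) := by
  rw [cube_eq_preimage]
  exact ((MeasurableEquiv.toLp 2 (Fin d → ℝ)).symm).measurable measurableSet_Icc

lemma volume_cube {R : ℝ} (_hR : 0 ≤ R) : volume (cube d R) = ENNReal.ofReal (2 * R) ^ d := by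
  rw [cube_eq_preimage, (EuclideanSpace.volume_preserving_symm_measurableEquiv_toLp
    (Fin d)).measure_preimage measurableSet_Icc.nullMeasurableSet, Real.volume_Icc_pi]
  simp [two_mul]

lemma integrable_cubeInd : Integrable (cubeInd d) := by
  unfold cubeInd
  rw [integrable_indicator_iff (measurableSet_cube 1)]
  apply integrableOn_const
  · rw [volume_cube zero_le_one]; simp
  · simp

lemma integral_cubeInd : ∫ x, cubeInd d x = 1 := by
  unfold cubeInd
  rw [integral_indicator (measurableSet_cube 1), setIntegral_const, measureReal_def,
    volume_cube zero_le_one]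
  simp

lemma cubeInd_scale {R : ℝ} (hR : 0 < R) (G : (EuclideanSpace ℝ (Fin d)) → ℂ) :
    ((2 * R) ^ d)⁻¹ • ∫ x in cube d R, G x
      = ∫ x, G x * (((R : ℂ) ^ d)⁻¹ * cubeInd d (R⁻¹ • x)) := by
  rw [← integral_indicator (measurableSet_cube R), ← integral_smul]
  refine integral_congr_ae (Eventually.of_forall fun x => ?_)
  dsimp only
  have hiff : R⁻¹ • x ∈ cube d 1 ↔ x ∈ cube d R := by
    simp only [cube, Set.mem_ofPred_eq, PiLp.smul_apply, smul_eq_mul, abs_mul, abs_inv,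
      abs_of_pos hR]
    refine forall_congr' fun i => ?_
    rw [inv_mul_le_iff₀ hR, mul_one]
  unfold cubeInd
  by_cases h : x ∈ cube d R
  · rw [Set.indicator_of_mem h, Set.indicator_of_mem (hiff.2 h), Complex.real_smul]
    push_cast
    rw [mul_pow, mul_inv]; ring
  · rw [Set.indicator_of_notMem h, Set.indicator_of_notMem (fun h' => h (hiff.1 h'))]
    simp

lemma integral_scale {E : Type*} [NormedAddCommGroup E] [NormedSpace ℝ E] {R : ℝ} (hR : 0 < R)
    (G : (EuclideanSpace ℝ (Fin d)) → E) : ∫ x, G (R⁻¹ • x) = R ^ d • ∫ x, G x := by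
  rw [Measure.integral_comp_smul]
  simp [abs_of_pos hR]

/-- The rescaled test function `ψ (R (ξ - k))`. -/
lemma exists_rescaled (ψ : SchwartzMap (EuclideanSpace ℝ (Fin d)) ℂ) (hψ : HasCompactSupport ψ) (k : (EuclideanSpace ℝ (Fin d))) {R : ℝ}
    (hR : 0 < R) : ∃ φ : SchwartzMap (EuclideanSpace ℝ (Fin d)) ℂ, HasCompactSupport φ ∧ (∀ ξ, φ ξ = ψ (R • (ξ - k))) ∧
      ∀ x, 𝓕 φ x = eChar k x * (((R : ℂ) ^ d)⁻¹ * 𝓕 ψ (R⁻¹ • x)) := by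
  let e : (EuclideanSpace ℝ (Fin d)) ≃ₜ (EuclideanSpace ℝ (Fin d)) := (Homeomorph.subRight k).trans (Homeomorph.smulOfNeZero R hR.ne')
  have hc : HasCompactSupport (fun ξ => ψ (R • (ξ - k))) := hψ.comp_homeomorph e
  have hs : ContDiff ℝ (⊤ : ℕ∞) (fun ξ => ψ (R • (ξ - k))) :=
    (ψ.smooth ⊤).comp (by fun_prop)
  refine ⟨hc.toSchwartzMap hs, hc, fun ξ => rfl, fun x => ?_⟩
  rw [fourier_eq_eChar, fourier_eq_eChar]
  change ∫ v, eChar x v * ψ (R • (v - k)) = _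
  rw [← integral_add_right_eq_self _ k]
  simp only [add_sub_cancel_right]
  have h1 : ∀ v, eChar x (v + k) * ψ (R • v) =
      eChar k x * ((fun w => eChar (R⁻¹ • x) w * ψ w) ((R⁻¹)⁻¹ • v)) := by
    intro v
    dsimp only
    rw [eChar_add_right, eChar_comm x k, inv_inv, eChar_smul, inv_smul_smul₀ hR.ne']
    ring
  rw [integral_congr_ae (Eventually.of_forall h1), integral_const_mul,
    integral_scale (inv_pos.2 hR) (fun w => eChar (R⁻¹ • x) w * ψ w), Complex.real_smul]
  push_cast
  rw [inv_pow]

theorem hasMean_of_frel {g : (EuclideanSpace ℝ (Fin d)) → ℂ} {ν : Measure (EuclideanSpace ℝ (Fin d))} [IsLocallyFiniteMeasure ν] {F : (EuclideanSpace ℝ (Fin d)) → ℂ}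
    (hF : LocallyIntegrable F ν) (hg : AEStronglyMeasurable g) {C : ℝ} (hC : ∀ x, ‖g x‖ ≤ C)
    (hrel : FRel g ν F) (k : (EuclideanSpace ℝ (Fin d))) :
    HasMean (fun x => eChar k x * g x) ((ν {k}).toReal • F k) := by
  have hC0 : 0 ≤ C := (norm_nonneg _).trans (hC 0)
  set a : ℂ := (ν {k}).toReal • F k with ha
  -- smooth averages
  have step1 : ∀ ψ : SchwartzMap (EuclideanSpace ℝ (Fin d)) ℂ, HasCompactSupport ψ →
      Tendsto (fun R : ℝ => ∫ x, (eChar k x * g x) * (((R : ℂ) ^ d)⁻¹ * 𝓕 ψ (R⁻¹ • x))) atTop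
        (𝓝 (ψ 0 * a)) := by
    intro ψ hψ
    obtain ⟨ρ, hρ⟩ := hψ.isCompact.isBounded.subset_closedBall (0 : (EuclideanSpace ℝ (Fin d)))
    obtain ⟨B, hB⟩ := hψ.exists_bound_of_continuous ψ.continuous
    have hB0 : 0 ≤ B := (norm_nonneg _).trans (hB 0)
    have hzero : ∀ ξ, ρ < ‖ξ‖ → ψ ξ = 0 := by
      intro ξ h
      by_contra h'
      have := hρ (subset_tsupport _ h')
      rw [mem_closedBall_zero_iff] at this
      linarith
    have e1 : ∀ᶠ R : ℝ in atTop, ∫ ξ, ψ (R • (ξ - k)) * F ξ ∂ν =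
        ∫ x, (eChar k x * g x) * (((R : ℂ) ^ d)⁻¹ * 𝓕 ψ (R⁻¹ • x)) := by
      filter_upwards [eventually_gt_atTop 0] with R hR
      obtain ⟨φ, hφc, hφ, hφF⟩ := exists_rescaled ψ hψ k hR
      have := hrel φ hφc
      simp_rw [hφ] at this
      rw [← this]
      refine integral_congr_ae (Eventually.of_forall fun x => ?_)
      dsimp only
      rw [hφF]; ring
    refine Tendsto.congr' e1 ?_
    have e2 : ψ 0 * a = ∫ ξ, ({k} : Set (EuclideanSpace ℝ (Fin d))).indicator (fun ξ => ψ 0 * F ξ) ξ ∂ν := by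
      rw [integral_indicator (measurableSet_singleton k), integral_singleton, ha, measureReal_def,
        mul_smul_comm]
    rw [e2]
    refine tendsto_integral_filter_of_dominated_convergence
      ((closedBall k ρ).indicator fun ξ => B * ‖F ξ‖) ?_ ?_ ?_ ?_
    · refine Eventually.of_forall fun R => ?_
      exact (by fun_prop : Continuous fun ξ => ψ (R • (ξ - k))).aestronglyMeasurable.mul
        hF.aestronglyMeasurable
    · filter_upwards [eventually_ge_atTop 1] with R hR
      refine Eventually.of_forall fun ξ => ?_
      by_cases h : ξ ∈ closedBall k ρ
      · rw [Set.indicator_of_mem h, norm_mul]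
        exact mul_le_mul_of_nonneg_right (hB _) (norm_nonneg _)
      · rw [Set.indicator_of_notMem h, hzero, zero_mul, norm_zero]
        rw [mem_closedBall, not_le, dist_eq_norm] at h
        rw [norm_smul, Real.norm_of_nonneg (by linarith)]
        nlinarith [norm_nonneg (ξ - k)]
    · rw [integrable_indicator_iff measurableSet_closedBall]
      exact ((hF.integrableOn_isCompact (isCompact_closedBall k ρ)).norm.const_mul B)
    · refine Eventually.of_forall fun ξ => ?_
      by_cases h : ξ = k
      · subst h; simp
      · rw [Set.indicator_of_notMem (by simpa using h)]
        refine tendsto_const_nhds.congr' ?_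
        have hpos : 0 < ‖ξ - k‖ := norm_pos_iff.2 (sub_ne_zero.2 h)
        filter_upwards [eventually_gt_atTop 0, eventually_gt_atTop (ρ / ‖ξ - k‖)] with R hR0 hR
        rw [hzero, zero_mul]
        rw [norm_smul, Real.norm_of_nonneg hR0.le]
        rwa [div_lt_iff₀ hpos] at hR
  -- approximation
  unfold HasMean
  rw [Metric.tendsto_atTop']
  intro ε hε
  set δ : ℝ := ε / (2 * (C + ‖a‖ + 1)) with hδ
  have hδ0 : 0 < δ := by positivity
  obtain ⟨ψ, hψ, hψ1⟩ := exists_testFn_L1_close (cubeInd d) integrable_cubeInd hδ0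
  have hψ0 : ‖1 - ψ 0‖ ≤ δ := by
    have h2 : ψ 0 = ∫ x, 𝓕 ψ x := by
      have h2 : ψ 0 = 𝓕⁻ (𝓕 ψ) 0 := by rw [FourierTransform.fourierInv_fourier_eq]
      rw [fourierInv_eq_eChar] at h2
      simpa using h2
    rw [h2, ← integral_cubeInd (d := d), ← integral_sub integrable_cubeInd (𝓕 ψ).integrable]
    exact (norm_integral_le_integral_norm _).trans hψ1.le
  obtain ⟨N, hN⟩ := Metric.tendsto_atTop'.1 (step1 ψ hψ) (ε / 2) (by positivity)
  refine ⟨max N 0, fun R hR => ?_⟩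
  have hR0 : 0 < R := lt_of_le_of_lt (le_max_right _ _) hR
  have hRN := hN R (lt_of_le_of_lt (le_max_left _ _) hR)
  rw [cubeInd_scale hR0]
  set G : (EuclideanSpace ℝ (Fin d)) → ℂ := fun x => eChar k x * g x with hG
  have hGm : AEStronglyMeasurable G := 
    (by fun_prop : Continuous fun x : (EuclideanSpace ℝ (Fin d)) => eChar k x).aestronglyMeasurable.mul hg
  have hGb : ∀ x, ‖G x‖ ≤ C := fun x => by simpa [hG] using hC x
  have hsc : ∀ v : (EuclideanSpace ℝ (Fin d)) → ℂ, Integrable v → Integrable fun x => G x * (((R : ℂ) ^ d)⁻¹ * v (R⁻¹ • x)) := by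
    intro v hv
    refine Integrable.bdd_mul (c := C) ?_ hGm (Eventually.of_forall hGb)
    exact (hv.comp_smul (inv_ne_zero hR0.ne')).const_mul _
  have hdiff : ‖(∫ x, G x * (((R : ℂ) ^ d)⁻¹ * cubeInd d (R⁻¹ • x))) -
      ∫ x, G x * (((R : ℂ) ^ d)⁻¹ * 𝓕 ψ (R⁻¹ • x))‖ ≤ C * δ := by
    rw [← integral_sub (hsc _ integrable_cubeInd) (hsc _ (𝓕 ψ).integrable)]
    have h3 : ∫ x : (EuclideanSpace ℝ (Fin d)), C * ((R ^ d)⁻¹ * ‖cubeInd d (R⁻¹ • x) - 𝓕 ψ (R⁻¹ • x)‖)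
        = C * ∫ x, ‖cubeInd d x - 𝓕 ψ x‖ := by
      rw [integral_const_mul, integral_const_mul,
        integral_scale hR0 (fun x => ‖cubeInd d x - 𝓕 ψ x‖), smul_eq_mul,
        inv_mul_cancel_left₀ (by positivity)]
    refine le_trans ?_ (h3.le.trans (mul_le_mul_of_nonneg_left hψ1.le hC0))
    refine norm_integral_le_of_norm_le ?_ (Eventually.of_forall fun x => ?_)
    · have : Integrable fun x => ‖cubeInd d x - 𝓕 ψ x‖ :=
        (integrable_cubeInd.sub (𝓕 ψ).integrable).norm
      exact ((this.comp_smul (inv_ne_zero hR0.ne')).const_mul _).const_mul _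
    · rw [← mul_sub, ← mul_sub, norm_mul (G x), norm_mul (((R : ℂ) ^ d)⁻¹)]
      have : ‖((R : ℂ) ^ d)⁻¹‖ = (R ^ d)⁻¹ := by
        rw [norm_inv, norm_pow, Complex.norm_real, Real.norm_of_nonneg hR0.le]
      rw [this]
      exact mul_le_mul_of_nonneg_right (hGb x) (by positivity)
  rw [dist_eq_norm] at hRN ⊢
  have h4 : ‖ψ 0 * a - a‖ ≤ δ * ‖a‖ := by
    have : ψ 0 * a - a = -((1 - ψ 0) * a) := by ring
    rw [this, norm_neg, norm_mul]
    exact mul_le_mul_of_nonneg_right hψ0 (norm_nonneg _)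
  have h5 : C * δ + δ * ‖a‖ < ε / 2 := by
    have : δ * (C + ‖a‖ + 1) = ε / 2 := by
      rw [hδ]; field_simp
    nlinarith
  have h6 := norm_sub_le_norm_sub_add_norm_sub
    (∫ x, G x * (((R : ℂ) ^ d)⁻¹ * cubeInd d (R⁻¹ • x)))
    (∫ x, G x * (((R : ℂ) ^ d)⁻¹ * 𝓕 ψ (R⁻¹ • x))) a
  have h7 := norm_sub_le_norm_sub_add_norm_sub
    (∫ x, G x * (((R : ℂ) ^ d)⁻¹ * 𝓕 ψ (R⁻¹ • x))) (ψ 0 * a) a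
  linarith

end Part3

section Part4

variable {d : ℕ}

lemma isCompact_cube (R : ℝ) : IsCompact (cube d R) := by
  have : cube d R = (EuclideanSpace.equiv (Fin d) ℝ).toHomeomorph ⁻¹'
      (Set.Icc (fun _ => -R) (fun _ => R)) := by
    ext x
    simp only [cube, Set.mem_ofPred_eq, Set.mem_preimage, Set.mem_Icc, Pi.le_def, abs_le,
      forall_and]
    rfl
  rw [this, Homeomorph.isCompact_preimage]
  exact isCompact_Icc

lemma HasMean.sub' {g h : (EuclideanSpace ℝ (Fin d)) → ℂ} {m n : ℂ} (hg : HasMean g m) (hh : HasMean h n)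
    (cg : Continuous g) (ch : Continuous h) : HasMean (fun x => g x - h x) (m - n) := by
  refine (Filter.Tendsto.sub hg hh).congr fun R => ?_
  rw [integral_sub (cg.continuousOn.integrableOn_compact (isCompact_cube R))
    (ch.continuousOn.integrableOn_compact (isCompact_cube R)), smul_sub]

lemma HasMean.const_mul' {g : (EuclideanSpace ℝ (Fin d)) → ℂ} {m : ℂ} (hg : HasMean g m) (c : ℂ) :
    HasMean (fun x => c * g x) (c * m) := by
  refine (Filter.Tendsto.const_mul c hg).congr fun R => ?_
  rw [integral_const_mul, mul_smul_comm]

lemma HasMean.sum' {ι : Type*} (s : Finset ι) {g : ι → (EuclideanSpace ℝ (Fin d)) → ℂ} {m : ι → ℂ}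
    (hg : ∀ i ∈ s, HasMean (g i) (m i)) (cg : ∀ i ∈ s, Continuous (g i)) :
    HasMean (fun x => ∑ i ∈ s, g i x) (∑ i ∈ s, m i) := by
  refine (tendsto_finsetSum s hg).congr fun R => ?_
  rw [integral_finsetSum s fun i hi =>
    ((cg i hi).continuousOn.integrableOn_compact (isCompact_cube R)), Finset.smul_sum]

lemma HasMean.re_le {g : (EuclideanSpace ℝ (Fin d)) → ℂ} {m : ℂ} (hg : HasMean g m) (cg : Continuous g) {B : ℝ}
    (hB : ∀ x, (g x).re ≤ B) : m.re ≤ B := by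
  have h1 := (Complex.continuous_re.tendsto m).comp hg
  refine le_of_tendsto h1 ?_
  filter_upwards [eventually_gt_atTop 0] with R hR
  have hi : IntegrableOn g (cube d R) := cg.continuousOn.integrableOn_compact (isCompact_cube R)
  have h2 : (∫ x in cube d R, g x).re = ∫ x in cube d R, (g x).re := (integral_re hi).symm
  have hv : volume (cube d R) ≠ ⊤ := (isCompact_cube R).measure_lt_top.ne
  have h3 : ∫ x in cube d R, (g x).re ≤ ∫ x in cube d R, B :=
    integral_mono hi.re (integrableOn_const hv) hB
  rw [setIntegral_const, measureReal_def, volume_cube hR.le, ENNReal.toReal_pow,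
    ENNReal.toReal_ofReal (by positivity), smul_eq_mul] at h3
  change (((2 * R) ^ d)⁻¹ • ∫ x in cube d R, g x).re ≤ B
  rw [Complex.smul_re, h2, smul_eq_mul, inv_mul_le_iff₀ (by positivity)]
  exact h3

lemma hasMean_orth (l k : (EuclideanSpace ℝ (Fin d))) :
    HasMean (fun x => eChar l x * eChar k (-x)) (if l = k then 1 else 0) := by
  have hInt : Integrable (fun _ : (EuclideanSpace ℝ (Fin d)) => (1:ℂ)) (Measure.dirac k) := integrable_const _
  have h1 : ∀ x, ftm (Measure.dirac k) (fun _ => (1:ℂ)) x = eChar k (-x) := by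
    intro x
    simp [ftm]
  have h := hasMean_of_frel (g := fun x => eChar k (-x)) (ν := Measure.dirac k)
    (F := fun _ => (1:ℂ)) (C := 1) hInt.locallyIntegrable
    (by fun_prop : Continuous fun x => eChar k (-x)).aestronglyMeasurable (by simp)
    (by
      intro ψ _
      rw [← frel_ftm hInt ψ]
      simp_rw [h1]) l
  convert h using 1
  rw [Measure.dirac_apply' _ (measurableSet_singleton l)]
  by_cases hlk : l = k
  · simp [hlk]
  · simp [hlk, Ne.symm hlk]

theorem bessel {g : (EuclideanSpace ℝ (Fin d)) → ℂ} (hg : Continuous g) {C : ℝ} (hC : ∀ x, ‖g x‖ ≤ C) {a : (EuclideanSpace ℝ (Fin d)) → ℂ}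
    (ha : ∀ k, HasMean (fun x => eChar k x * g x) (a k)) : Summable fun k => ‖a k‖ ^ 2 := by
  classical
  refine summable_of_sum_le (c := C ^ 2) (fun _ => by positivity) fun s => ?_
  set P : (EuclideanSpace ℝ (Fin d)) → ℂ := fun x => ∑ k ∈ s, a k * eChar k (-x) with hP
  set Q : (EuclideanSpace ℝ (Fin d)) → ℂ := fun x => ∑ k ∈ s, conj (a k) * eChar k x with hQ
  have hPQ : ∀ x, conj (P x) = Q x := by
    intro x
    simp [hP, hQ, eChar_conj]
  have cP : Continuous P := by
    apply continuous_finsetSum; intro k _; fun_prop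
  have cQ : Continuous Q := by
    apply continuous_finsetSum; intro k _; fun_prop
  set S : ℂ := ∑ k ∈ s, conj (a k) * a k with hS
  have hSre : S.re = ∑ k ∈ s, ‖a k‖ ^ 2 := by
    rw [hS, Complex.re_sum]
    refine Finset.sum_congr rfl fun k _ => ?_
    rw [Complex.conj_mul', ← Complex.ofReal_pow, Complex.ofReal_re]
  have m1 : HasMean (fun x => Q x * g x) S := by
    have := HasMean.sum' s (g := fun k x => conj (a k) * (eChar k x * g x))
      (fun k _ => (ha k).const_mul' (conj (a k))) (fun k _ => by fun_prop)
    convert this using 2 with x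
    rw [hQ, Finset.sum_mul]
    simp only [mul_assoc]
  have m2 : HasMean (fun x => Q x * P x) S := by
    have := HasMean.sum' s (g := fun k x => conj (a k) * ∑ l ∈ s, a l * (eChar k x * eChar l (-x)))
      (fun k _ => (HasMean.sum' s (fun l _ => (hasMean_orth k l).const_mul' (a l))
        (fun l _ => by fun_prop)).const_mul' (conj (a k)))
      (fun k _ => by
        refine continuous_const.mul (continuous_finsetSum _ fun l _ => by fun_prop))
    convert this using 2 with x
    · rw [hQ, hP, Finset.sum_mul]
      refine Finset.sum_congr rfl fun k _ => ?_
      rw [mul_assoc, Finset.mul_sum]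
      congr 1
      refine Finset.sum_congr rfl fun l _ => ?_
      ring
    · rename_i k hk
      simp [hk]
  have m3 := (m1.const_mul' 2).sub' m2 (by fun_prop) (by fun_prop)
  have h4 := m3.re_le (B := C ^ 2) (by fun_prop) fun x => by
    rw [← hPQ]
    have h5 : ‖g x‖ ^ 2 ≤ C ^ 2 := by
      have := hC x
      gcongr
    refine le_trans ?_ h5
    rw [← Complex.normSq_eq_norm_sq]
    simp only [Complex.normSq_apply, Complex.sub_re, Complex.mul_re, Complex.mul_im,
      Complex.conj_re, Complex.conj_im, Complex.re_ofNat, Complex.im_ofNat]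
    nlinarith [sq_nonneg ((g x).re - (P x).re), sq_nonneg ((g x).im - (P x).im)]
  have h6 : (2 * S - S).re = S.re := by congr 1; ring
  rw [h6, hSre] at h4
  exact h4

theorem wiener {ν : Measure (EuclideanSpace ℝ (Fin d))} [IsLocallyFiniteMeasure ν] {F : (EuclideanSpace ℝ (Fin d)) → ℂ} (hF : Integrable F ν)
    (hν : ∀ x, ν {x} = 0) : HasMean (fun x => conj (ftm ν F x) * ftm ν F x) 0 := by
  set w := ftm ν F with hw
  have cw : Continuous w := continuous_ftm hF
  set C : ℝ := ∫ ξ, ‖F ξ‖ ∂ν with hC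
  have hwC : ∀ x, ‖w x‖ ≤ C := fun x => ftm_norm_le x
  have hC0 : 0 ≤ C := (norm_nonneg _).trans (hwC 0)
  have hconj : ∀ x, conj (w x) = ∫ η, eChar η x * conj (F η) ∂ν := by
    intro x
    rw [hw, ftm, ← integral_conj]
    refine integral_congr_ae (Eventually.of_forall fun ξ => ?_)
    simp [eChar_conj]
  have hFc : Integrable (fun η => conj (F η)) ν :=
    (LinearIsometryEquiv.integrable_comp_iff Complex.conjLIE).2 hF
  have key : ∀ R : ℝ, ((2 * R) ^ d)⁻¹ • ∫ x in cube d R, conj (w x) * w x =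
      ∫ η, conj (F η) * (((2 * R) ^ d)⁻¹ • ∫ x in cube d R, eChar η x * w x) ∂ν := by
    intro R
    have h1 : ∀ x, conj (w x) * w x = ∫ η, conj (F η) * (eChar η x * w x) ∂ν := by
      intro x
      rw [hconj, ← integral_mul_const]
      refine integral_congr_ae (Eventually.of_forall fun ξ => ?_)
      dsimp only; ring
    simp_rw [h1]
    rw [integral_integral_swap]
    · rw [← integral_smul]
      refine integral_congr_ae (Eventually.of_forall fun η => ?_)
      dsimp only
      rw [integral_const_mul, mul_smul_comm]
    · have hwi : Integrable w (volume.restrict (cube d R)) :=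
        cw.continuousOn.integrableOn_compact (isCompact_cube R)
      have h2 := hwi.mul_prod hFc
      have h3 : Integrable (fun z : (EuclideanSpace ℝ (Fin d)) × (EuclideanSpace ℝ (Fin d)) => eChar z.2 z.1 * (w z.1 * conj (F z.2)))
          ((volume.restrict (cube d R)).prod ν) := by
        refine Integrable.bdd_mul (c := 1) h2 ?_ (by simp)
        exact (by fun_prop : Continuous fun z : (EuclideanSpace ℝ (Fin d)) × (EuclideanSpace ℝ (Fin d)) => eChar z.2 z.1).aestronglyMeasurable
      refine h3.congr (Eventually.of_forall fun z => ?_)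
      simp only [Function.uncurry]
      ring
  unfold HasMean
  simp_rw [key]
  have h0 : (0:ℂ) = ∫ η, (0:ℂ) ∂ν := by simp
  rw [h0]
  refine tendsto_integral_filter_of_dominated_convergence (fun η => ‖F η‖ * C) ?_ ?_ ?_ ?_
  · refine Eventually.of_forall fun R => hFc.aestronglyMeasurable.mul ?_
    have : Continuous (Function.uncurry fun η x : (EuclideanSpace ℝ (Fin d)) => eChar η x * w x) := by
      simp only [Function.uncurry_def]
      fun_prop
    exact ((this.stronglyMeasurable.integral_prod_right
      (ν := volume.restrict (cube d R))).aestronglyMeasurable).const_smul (((2 * R) ^ d)⁻¹)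
  · filter_upwards [eventually_gt_atTop 0] with R hR
    refine Eventually.of_forall fun η => ?_
    rw [norm_mul, RCLike.norm_conj]
    refine mul_le_mul_of_nonneg_left ?_ (norm_nonneg _)
    have hv : volume (cube d R) < ⊤ := (isCompact_cube R).measure_lt_top
    have h3 := norm_setIntegral_le_of_norm_le_const (f := fun x => eChar η x * w x) (C := C) hv
      (fun x _ => by simpa using hwC x)
    rw [measureReal_def, volume_cube hR.le, ENNReal.toReal_pow,
      ENNReal.toReal_ofReal (by positivity)] at h3
    rw [norm_smul, norm_inv, Real.norm_of_nonneg (by positivity), inv_mul_le_iff₀ (by positivity),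
      mul_comm]
    exact h3
  · exact hF.norm.mul_const _
  · refine Eventually.of_forall fun η => ?_
    have h4 := hasMean_of_frel hF.locallyIntegrable cw.aestronglyMeasurable hwC
      (fun ψ _ => frel_ftm hF ψ) η
    rw [hν] at h4
    have h5 := Filter.Tendsto.const_mul (conj (F η)) h4
    simpa using h5

end Part4

section Part5

variable {d : ℕ}

/-- The set of translates of `g` is totally bounded in the uniform norm (colouring form). -/
def TB (g : (EuclideanSpace ℝ (Fin d)) → ℂ) : Prop := ∀ ε : ℝ, 0 < ε → ∃ (ι : Type) (_ : Fintype ι) (c : (EuclideanSpace ℝ (Fin d)) → ι),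
  ∀ t s, c t = c s → ∀ x, ‖g (x + t) - g (x + s)‖ ≤ ε

lemma exists_colouring {Y : Type} [PseudoMetricSpace Y] {K : Set Y} (hK : TotallyBounded K)
    (q : (EuclideanSpace ℝ (Fin d)) → Y) (hq : ∀ t, q t ∈ K) {ε : ℝ} (hε : 0 < ε) :
    ∃ (ι : Type) (_ : Fintype ι) (c : (EuclideanSpace ℝ (Fin d)) → ι), ∀ t s, c t = c s → dist (q t) (q s) < ε := by
  obtain ⟨T, hT, hcov⟩ := Metric.totallyBounded_iff.1 hK (ε / 2) (by positivity)
  have h1 : ∀ t, ∃ y : T, dist (q t) y < ε / 2 := by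
    intro t
    have := hcov (hq t)
    simp only [Set.mem_iUnion, mem_ball] at this
    obtain ⟨y, hy, h⟩ := this
    exact ⟨⟨y, hy⟩, h⟩
  choose c hc using h1
  refine ⟨T, hT.fintype, c, fun t s hts => ?_⟩
  have h2 := hc t
  have h3 := hc s
  rw [← hts] at h3
  have := dist_triangle_right (q t) (q s) (c t)
  linarith

lemma TB.sub {g h : (EuclideanSpace ℝ (Fin d)) → ℂ} (hg : TB g) (hh : TB h) : TB fun x => g x - h x := by
  intro ε hε
  obtain ⟨ι, _, c, hc⟩ := hg (ε / 2) (by positivity)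
  obtain ⟨κ, _, e, he⟩ := hh (ε / 2) (by positivity)
  refine ⟨ι × κ, inferInstance, fun t => (c t, e t), fun t s hts x => ?_⟩
  rw [Prod.mk.injEq] at hts
  have h1 := hc t s hts.1 x
  have h2 := he t s hts.2 x
  have h3 : g (x + t) - h (x + t) - (g (x + s) - h (x + s)) =
    (g (x + t) - g (x + s)) - (h (x + t) - h (x + s)) := by ring
  rw [h3]
  refine (norm_sub_le _ _).trans (by linarith)

lemma TB.zero : TB (fun _ : (EuclideanSpace ℝ (Fin d)) => (0:ℂ)) := fun ε hε =>
  ⟨Unit, inferInstance, fun _ => (), fun _ _ _ _ => by simpa using hε.le⟩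

lemma TB.add {g h : (EuclideanSpace ℝ (Fin d)) → ℂ} (hg : TB g) (hh : TB h) : TB fun x => g x + h x := by
  have := hg.sub (TB.zero.sub hh)
  simpa using this

lemma TB.sum {ι : Type*} (s : Finset ι) {g : ι → (EuclideanSpace ℝ (Fin d)) → ℂ} (hg : ∀ i, TB (g i)) :
    TB fun x => ∑ i ∈ s, g i x := by
  classical
  induction s using Finset.induction_on with
  | empty => simpa using TB.zero
  | insert a s ha ih => simpa [Finset.sum_insert ha] using (hg a).add ih

lemma TB.limit {g : (EuclideanSpace ℝ (Fin d)) → ℂ} (H : ∀ ε : ℝ, 0 < ε → ∃ h, TB h ∧ ∀ x, ‖g x - h x‖ ≤ ε) : TB g := by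
  intro ε hε
  obtain ⟨h, hh, hgh⟩ := H (ε / 3) (by positivity)
  obtain ⟨ι, i, c, hc⟩ := hh (ε / 3) (by positivity)
  refine ⟨ι, i, c, fun t s hts x => ?_⟩
  have h1 := hc t s hts x
  have h2 := hgh (x + t)
  have h3 := hgh (x + s)
  have h4 : g (x + t) - g (x + s) = (g (x + t) - h (x + t)) + (h (x + t) - h (x + s)) -
    (g (x + s) - h (x + s)) := by ring
  rw [h4]
  refine (norm_sub_le _ _).trans ?_
  have := norm_add_le (g (x + t) - h (x + t)) (h (x + t) - h (x + s))
  linarith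

lemma TB.eChar (a : ℂ) (k : (EuclideanSpace ℝ (Fin d))) : TB fun x => a * eChar k (-x) := by
  intro ε hε
  obtain ⟨ι, i, c, hc⟩ := exists_colouring (isCompact_closedBall (0:ℂ) ‖a‖).totallyBounded
    (fun t : (EuclideanSpace ℝ (Fin d)) => a * _root_.eChar k (-t)) (by simp) hε
  refine ⟨ι, i, c, fun t s hts x => ?_⟩
  have h1 := hc t s hts
  rw [dist_eq_norm] at h1
  have h2 : a * _root_.eChar k (-(x + t)) - a * _root_.eChar k (-(x + s)) =
      _root_.eChar k (-x) * (a * _root_.eChar k (-t) - a * _root_.eChar k (-s)) := by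
    rw [neg_add, neg_add, eChar_add_right, eChar_add_right]; ring
  rw [h2, norm_mul, eChar_norm, one_mul]
  exact h1.le

lemma TB.of_bohr {g : (EuclideanSpace ℝ (Fin d)) → ℂ} (hg : IsBohrAP g) : TB g := by
  intro ε hε
  obtain ⟨hu, -, hap⟩ := hg
  obtain ⟨r, hr⟩ := hap (ε / 3) (by positivity)
  choose τ hτ hτr using hr
  obtain ⟨δ, hδ, hδg⟩ := Metric.uniformContinuous_iff.1 hu (ε / 3) (by positivity)
  obtain ⟨ι, i, c, hc⟩ := exists_colouring (isCompact_closedBall (0 : (EuclideanSpace ℝ (Fin d))) r).totallyBounded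
    (fun t => t - τ t) (fun t => by
      rw [mem_closedBall_zero_iff, ← dist_eq_norm]; exact hτr t) hδ
  refine ⟨ι, i, c, fun t s hts x => ?_⟩
  have h1 := hc t s hts
  have h2 := hτ t (x + t)
  have h3 := hτ s (x + s)
  have h4 : dist (g (x + t - τ t)) (g (x + s - τ s)) < ε / 3 := by
    apply hδg
    rw [add_sub_assoc, add_sub_assoc, dist_add_left]
    exact h1
  rw [dist_eq_norm] at h4
  have h5 : g (x + t) - g (x + s) = -(g (x + t - τ t) - g (x + t)) +
    (g (x + t - τ t) - g (x + s - τ s)) + (g (x + s - τ s) - g (x + s)) := by ring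
  rw [h5]
  have h6 := norm_add₃_le (a := -(g (x + t - τ t) - g (x + t)))
    (b := (g (x + t - τ t) - g (x + s - τ s))) (c := (g (x + s - τ s) - g (x + s)))
  rw [norm_neg] at h6
  linarith

lemma TB.conv {g φ : (EuclideanSpace ℝ (Fin d)) → ℂ} (hg : TB g) (cg : Continuous g) {C : ℝ} (hC : ∀ x, ‖g x‖ ≤ C)
    (hφ : Integrable φ) : TB fun x => ∫ y, g (y + x) * φ y := by
  intro ε hε
  set B : ℝ := ∫ y, ‖φ y‖ with hB
  have hB0 : 0 ≤ B := integral_nonneg fun _ => norm_nonneg _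
  obtain ⟨ι, i, c, hc⟩ := hg (ε / (B + 1)) (by positivity)
  refine ⟨ι, i, c, fun t s hts x => ?_⟩
  have hInt : ∀ x, Integrable fun y => g (y + x) * φ y := fun x =>
    hφ.bdd_mul (c := C) (by fun_prop : Continuous fun y => g (y + x)).aestronglyMeasurable
      (Eventually.of_forall fun y => hC _)
  rw [← integral_sub (hInt _) (hInt _)]
  have h1 : ‖∫ y, g (y + (x + t)) * φ y - g (y + (x + s)) * φ y‖ ≤
      ∫ y, ε / (B + 1) * ‖φ y‖ := by
    refine norm_integral_le_of_norm_le (hφ.norm.const_mul _) (Eventually.of_forall fun y => ?_)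
    rw [← sub_mul, norm_mul, ← add_assoc, ← add_assoc]
    exact mul_le_mul_of_nonneg_right (hc t s hts _) (norm_nonneg _)
  refine h1.trans ?_
  rw [integral_const_mul, ← hB, div_mul_eq_mul_div, div_le_iff₀ (by positivity)]
  nlinarith

/-- Fourier transforms of finite atomic measures have totally bounded translates. -/
lemma TB.atomic {ν : Measure (EuclideanSpace ℝ (Fin d))} {S : Set (EuclideanSpace ℝ (Fin d))} (hS : S.Countable) {F : (EuclideanSpace ℝ (Fin d)) → ℂ}
    (hF : Integrable F (ν.restrict S)) : TB (ftm (ν.restrict S) F) := by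
  have := hS.to_subtype
  have hU : (⋃ i : S, ({(i : (EuclideanSpace ℝ (Fin d)))} : Set (EuclideanSpace ℝ (Fin d)))) = S := by
    ext x; simp
  have hd : Pairwise (Function.onFun Disjoint fun i : S => ({(i : (EuclideanSpace ℝ (Fin d)))} : Set (EuclideanSpace ℝ (Fin d)))) := by
    intro i j hij
    simpa [Function.onFun, Subtype.ext_iff] using fun h => hij (Subtype.ext h)
  have hs : ∀ {E : Type} [NormedAddCommGroup E] [NormedSpace ℝ E] [CompleteSpace E] (G : (EuclideanSpace ℝ (Fin d)) → E),
      Integrable G (ν.restrict S) →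
      HasSum (fun i : S => ν.real {(i : (EuclideanSpace ℝ (Fin d)))} • G i) (∫ x in S, G x ∂ν) := by
    intro E _ _ _ G hG
    have h := hasSum_integral_iUnion (μ := ν) (f := G) (s := fun i : S => ({(i : (EuclideanSpace ℝ (Fin d)))} : Set (EuclideanSpace ℝ (Fin d))))
      (fun i => measurableSet_singleton _) hd (by rw [hU]; exact hG)
    rw [hU] at h
    simpa [measureReal_def] using h
  have h1 := (hs (fun ξ => ‖F ξ‖) hF.norm).summable
  have h2 : ∀ x, ftm (ν.restrict S) F x = ∑' i : S, (ν.real {(i : (EuclideanSpace ℝ (Fin d)))} * F i) * _root_.eChar (i : (EuclideanSpace ℝ (Fin d))) (-x) := by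
    intro x
    rw [ftm, ← (hs _ (integrable_eChar_mul hF (-x))).tsum_eq]
    refine tsum_congr fun i => ?_
    rw [Complex.real_smul]; ring
  have h3 := tendstoUniformly_tsum (f := fun (i : S) (x : (EuclideanSpace ℝ (Fin d))) =>
    ((ν.real {(i : (EuclideanSpace ℝ (Fin d)))} : ℂ) * F i) * _root_.eChar (i : (EuclideanSpace ℝ (Fin d))) (-x)) h1 (fun i x => by
      rw [norm_mul, norm_mul, eChar_norm, mul_one, Complex.norm_real,
        Real.norm_of_nonneg measureReal_nonneg, smul_eq_mul])
  refine TB.limit fun ε hε => ?_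
  obtain ⟨s, hs'⟩ := (Metric.tendstoUniformly_iff.1 h3 ε hε).exists
  have hT := TB.sum s (fun i : S => TB.eChar ((ν.real {(i : (EuclideanSpace ℝ (Fin d)))} : ℂ) * F i) (i : (EuclideanSpace ℝ (Fin d))))
  refine ⟨_, hT, fun x => ?_⟩
  have := (hs' x).le
  rwa [dist_eq_norm, ← h2] at this

lemma TB.eq_zero {w : (EuclideanSpace ℝ (Fin d)) → ℂ} (hw : TB w) (cw : Continuous w)
    (hm : ∀ c, HasMean (fun x => conj (w (x + c)) * w (x + c)) 0) (x₀ : (EuclideanSpace ℝ (Fin d))) : w x₀ = 0 := by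
  by_contra hne
  have hpos : 0 < ‖w x₀‖ := norm_pos_iff.2 hne
  set ε := ‖w x₀‖ / 2 with hε
  have hε0 : 0 < ε := by positivity
  obtain ⟨ι, _, c, hc⟩ := hw ε hε0
  set rep : ι → (EuclideanSpace ℝ (Fin d)) := Function.invFun c with hrep
  have hcr : ∀ t, c (rep (c t)) = c t := fun t => Function.invFun_eq ⟨t, rfl⟩
  have hcc : Continuous (starRingEnd ℂ) := Complex.continuous_conj
  have h1 := HasMean.sum' Finset.univ (fun i (_ : i ∈ Finset.univ) => (hm (x₀ - rep i)).const_mul' (-1))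
    (fun i _ => by fun_prop)
  have h2 := h1.re_le (B := -ε ^ 2)
    (continuous_finsetSum _ fun i _ => by fun_prop) fun t => by
    rw [Complex.re_sum]
    have h3 : ∀ i, (-1 * (conj (w (t + (x₀ - rep i))) * w (t + (x₀ - rep i)))).re =
        -‖w (t + (x₀ - rep i))‖ ^ 2 := by
      intro i
      rw [Complex.conj_mul', neg_one_mul, Complex.neg_re, ← Complex.ofReal_pow, Complex.ofReal_re]
    simp_rw [h3]
    rw [Finset.sum_neg_distrib, neg_le_neg_iff]
    have h4 : ε ^ 2 ≤ ‖w (t + (x₀ - rep (c t)))‖ ^ 2 := by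
      have h5 := hc t (rep (c t)) (hcr t).symm (x₀ - rep (c t))
      rw [sub_add_cancel] at h5
      have h6 := norm_sub_norm_le (w x₀) (w (x₀ - rep (c t) + t))
      rw [norm_sub_rev] at h5
      rw [add_comm t]
      have h7 : ε ≤ ‖w (x₀ - rep (c t) + t)‖ := by linarith
      gcongr
    exact h4.trans (Finset.single_le_sum (f := fun i => ‖w (t + (x₀ - rep i))‖ ^ 2)
      (fun i _ => by positivity) (Finset.mem_univ (c t)))
  simp at h2
  nlinarith

lemma ftm_translate (ν : Measure (EuclideanSpace ℝ (Fin d))) (F : (EuclideanSpace ℝ (Fin d)) → ℂ) (x c : (EuclideanSpace ℝ (Fin d))) :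
    ftm ν F (x + c) = ftm ν (fun ξ => eChar ξ (-c) * F ξ) x := by
  unfold ftm
  refine integral_congr_ae (Eventually.of_forall fun ξ => ?_)
  dsimp only
  rw [neg_add, eChar_add_right, mul_assoc]

lemma ftm_eq_conv {g : (EuclideanSpace ℝ (Fin d)) → ℂ} {ν : Measure (EuclideanSpace ℝ (Fin d))} {F : (EuclideanSpace ℝ (Fin d)) → ℂ} (h : FRel g ν F)
    (ψ : SchwartzMap (EuclideanSpace ℝ (Fin d)) ℂ) (hψ : HasCompactSupport ψ) (x : (EuclideanSpace ℝ (Fin d))) :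
    ftm ν (fun ξ => ψ ξ * F ξ) x = ∫ y, g (y + x) * 𝓕 ψ y := by
  have hc : HasCompactSupport (fun ξ => eChar ξ (-x) * ψ ξ) := hψ.mul_left
  have hs : ContDiff ℝ (⊤ : ℕ∞) (fun ξ => eChar ξ (-x) * ψ ξ) := by
    refine ContDiff.mul ?_ (ψ.smooth ⊤)
    unfold eChar
    refine Complex.contDiff_exp.comp (ContDiff.mul ?_ contDiff_const)
    have h0 : ContDiff ℝ (⊤ : ℕ∞) fun ξ : (EuclideanSpace ℝ (Fin d)) => -(2 * Real.pi * (inner ℝ (-x) ξ : ℝ)) :=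
      (contDiff_const.mul (contDiff_const.inner ℝ contDiff_id)).neg
    exact Complex.ofRealCLM.contDiff.comp h0
  have h1 := h (hc.toSchwartzMap hs) hc
  have h2 : ∀ y, 𝓕 (hc.toSchwartzMap hs) y = 𝓕 ψ (y - x) := by
    intro y
    rw [fourier_eq_eChar, fourier_eq_eChar]
    refine integral_congr_ae (Eventually.of_forall fun v => ?_)
    change eChar y v * (eChar v (-x) * ψ v) = eChar (y - x) v * ψ v
    rw [sub_eq_add_neg, eChar_add_left, eChar_comm v (-x)]; ring
  simp_rw [h2] at h1
  rw [← integral_add_right_eq_self _ x] at h1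
  simp only [add_sub_cancel_right] at h1
  rw [h1, ftm]
  refine integral_congr_ae (Eventually.of_forall fun ξ => ?_)
  change eChar ξ (-x) * (ψ ξ * F ξ) = (eChar ξ (-x) * ψ ξ) * F ξ
  ring

end Part5

section Part6

variable {d : ℕ}

theorem pure_point_part {g : (EuclideanSpace ℝ (Fin d)) → ℂ} {ν : Measure (EuclideanSpace ℝ (Fin d))} [IsLocallyFiniteMeasure ν] {F : (EuclideanSpace ℝ (Fin d)) → ℂ}
    (hF : LocallyIntegrable F ν) (hg : IsBohrAP g) (hrel : FRel g ν F) :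
    ∃ S : Set (EuclideanSpace ℝ (Fin d)), S.Countable ∧ ∀ᵐ ξ ∂(ν.restrict Sᶜ), F ξ = 0 := by
  set S : Set (EuclideanSpace ℝ (Fin d)) := {x | 0 < ν {x}} with hSdef
  have hS : S.Countable := Measure.countable_meas_pos_of_disjoint_iUnion
    (μ := ν) (As := fun x : (EuclideanSpace ℝ (Fin d)) => ({x} : Set (EuclideanSpace ℝ (Fin d)))) (fun x => measurableSet_singleton x)
    (fun x y hxy => by simpa [Function.onFun] using hxy)
  have hSm : MeasurableSet S := hS.measurableSet
  have hlf : IsLocallyFiniteMeasure (ν.restrict Sᶜ) := inferInstance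
  have hna : ∀ x, (ν.restrict Sᶜ) {x} = 0 := by
    intro x
    rw [Measure.restrict_apply (measurableSet_singleton x)]
    by_cases hx : x ∈ S
    · have : ({x} : Set (EuclideanSpace ℝ (Fin d))) ∩ Sᶜ = ∅ := by
        ext y; simp only [Set.mem_inter_iff, Set.mem_singleton_iff, Set.mem_compl_iff,
          Set.mem_empty_iff_false, iff_false]
        rintro ⟨rfl, h⟩; exact h hx
      rw [this, measure_empty]
    · have h0 : ν {x} = 0 := by
        by_contra h; exact hx (pos_iff_ne_zero.2 h)
      exact measure_mono_null Set.inter_subset_left h0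
  obtain ⟨C, hC⟩ := hg.2.1
  have cg : Continuous g := hg.1.continuous
  refine ⟨S, hS, ?_⟩
  have hFr : LocallyIntegrable F (ν.restrict Sᶜ) := by
    intro x
    obtain ⟨U, hU, hi⟩ := hF x
    exact ⟨U, hU, hi.mono_measure Measure.restrict_le_self⟩
  refine ae_eq_zero_of_integral_contDiff_smul_eq_zero hFr fun u hu huc => ?_
  have hc : HasCompactSupport (fun ξ => (u ξ : ℂ)) := huc.comp_left Complex.ofReal_zero
  have hs : ContDiff ℝ (⊤ : ℕ∞) (fun ξ => (u ξ : ℂ)) := Complex.ofRealCLM.contDiff.comp hu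
  set ψ : SchwartzMap (EuclideanSpace ℝ (Fin d)) ℂ := hc.toSchwartzMap hs with hψ
  have hψc : HasCompactSupport ψ := hc
  have hInt : Integrable (fun ξ => ψ ξ * F ξ) ν := by
    have := hF.integrable_smul_left_of_hasCompactSupport ψ.continuous hψc
    simpa using this
  have tb1 : TB (ftm ν fun ξ => ψ ξ * F ξ) := by
    have h1 := (TB.of_bohr hg).conv cg hC (𝓕 ψ).integrable
    have h2 : (ftm ν fun ξ => ψ ξ * F ξ) = fun x => ∫ y, g (y + x) * 𝓕 ψ y := by
      funext x; exact ftm_eq_conv hrel ψ hψc x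
    rw [h2]; exact h1
  have tb2 : TB (ftm (ν.restrict S) fun ξ => ψ ξ * F ξ) := TB.atomic hS hInt.restrict
  have tb3 : TB (ftm (ν.restrict Sᶜ) fun ξ => ψ ξ * F ξ) := by
    have h1 := tb1.sub tb2
    convert h1 using 2 with x
    have h2 := integral_add_compl hSm (integrable_eChar_mul hInt (-x))
    simp only [ftm]
    rw [← h2]; ring
  have hz := tb3.eq_zero (continuous_ftm hInt.restrict) (fun c => by
    simp_rw [ftm_translate]
    exact wiener (integrable_eChar_mul hInt.restrict (-c)) hna) 0
  have : ∫ ξ in Sᶜ, u ξ • F ξ ∂ν = ftm (ν.restrict Sᶜ) (fun ξ => ψ ξ * F ξ) 0 := by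
    unfold ftm
    refine integral_congr_ae (Eventually.of_forall fun ξ => ?_)
    simp only [neg_zero, eChar_zero_right, one_mul, Complex.real_smul]
    rfl
  rw [this, hz]

end Part6

/-- If `T̂` agrees with a tempered measure `μ` and `T*f` is Bohr almost
periodic for some Schwartz `f`, then `f̂·μ` is pure point, the Fourier–Bohr coefficients of
`T*f` are `a_k(T*f) = f̂(k)·μ({k})`, and they are square-summable. -/
theorem fourierBohr_of_conv_sap (d : ℕ)
    (T : SchwartzMap (EuclideanSpace ℝ (Fin d)) ℂ →L[ℂ] ℂ)
    (μ : CMeasure (EuclideanSpace ℝ (Fin d)))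
    (hAg : μ.Agrees (fourierTD T))
    (f : SchwartzMap (EuclideanSpace ℝ (Fin d)) ℂ)
    (hf : IsBohrAP (convTD T f)) :
    (∃ S : Set (EuclideanSpace ℝ (Fin d)), S.Countable ∧
        μ.tv (Sᶜ ∩ {x | SchwartzMap.fourierTransformCLM ℂ f x ≠ 0}) = 0) ∧
    (∀ k : EuclideanSpace ℝ (Fin d),
        HasMean (fun x => eChar k x * convTD T f x)
          (SchwartzMap.fourierTransformCLM ℂ f k * μ.atom k)) ∧
    Summable (fun k : EuclideanSpace ℝ (Fin d) =>
      ‖SchwartzMap.fourierTransformCLM ℂ f k * μ.atom k‖ ^ 2) := by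
  have hlf := μ.locFin
  have hrel := frel_convTD hAg f
  have hF : LocallyIntegrable (fun ξ => 𝓕 f ξ * μ.density ξ) μ.tv :=
    density_locInt μ _ (𝓕 f).continuous
  obtain ⟨C, hC⟩ := hf.2.1
  have cg : Continuous (convTD T f) := hf.1.continuous
  have hmean : ∀ k : EuclideanSpace ℝ (Fin d),
      HasMean (fun x => eChar k x * convTD T f x)
        (SchwartzMap.fourierTransformCLM ℂ f k * μ.atom k) := by
    intro k
    have h := hasMean_of_frel hF cg.aestronglyMeasurable hC hrel k
    rw [← mul_smul_comm] at h
    exact h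
  refine ⟨?_, hmean, bessel cg hC hmean⟩
  obtain ⟨S, hS, h0⟩ := pure_point_part hF hf hrel
  refine ⟨S, hS, ?_⟩
  have hSm : MeasurableSet Sᶜ := hS.measurableSet.compl
  have h1 : ∀ᵐ ξ ∂(μ.tv.restrict Sᶜ), 𝓕 f ξ = 0 := by
    filter_upwards [h0, ae_restrict_of_ae μ.density_norm] with ξ h2 h3
    rcases mul_eq_zero.1 h2 with h | h
    · exact h
    · rw [h, norm_zero] at h3
      exact absurd h3 zero_ne_one
  have h2 := (ae_restrict_iff' hSm).1 h1
  rw [ae_iff] at h2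
  refine measure_mono_null ?_ h2
  rintro ξ ⟨h3, h4⟩
  intro h5
  exact h4 (h5 h3)
end
end

section
/- Let T ∈ 𝒮′(ℝ^d) be a tempered distribution such that T̂ agrees with a tempered measure μ, and assume T*f ∈ SAP(ℝ^d) for some Schwartz function f. If the zero set {ξ ∈ ℝ^d : f̂(ξ) = 0} is at most countable, then μ is a pure-point measure. -/
set_option linter.unusedSectionVars false

open MeasureTheory Filter Metric Complex SchwartzMap
open scoped Topology ENNReal NNReal ComplexConjugate

noncomputable section

section Pieces

variable {E : Type*} [NormedAddCommGroup E] [InnerProductSpace ℝ E] [FiniteDimensional ℝ E]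
  [MeasurableSpace E] [BorelSpace E]

lemma exists_test_tendsto (f : SchwartzMap E ℂ) :
    ∃ φ : ℕ → SchwartzMap E ℂ, (∀ n, HasCompactSupport (φ n)) ∧ Tendsto φ atTop (𝓝 f) := by
  let b : ContDiffBump (0 : E) := ⟨1, 2, one_pos, one_lt_two⟩
  have hb1 : HasCompactSupport (fun x : E => (b x : ℂ)) :=
    b.hasCompactSupport.comp_left (g := fun r : ℝ => (r : ℂ)) Complex.ofReal_zero
  have hb2 : ContDiff ℝ (⊤ : ℕ∞) (fun x : E => (b x : ℂ)) :=
    Complex.ofRealCLM.contDiff.comp b.contDiff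
  let χ : SchwartzMap E ℂ := hb1.toSchwartzMap hb2
  have hχ1 : ∀ x : E, ‖x‖ < 1 → χ x = 1 := by
    intro x hx
    show ((b x : ℝ) : ℂ) = 1
    rw [b.one_of_mem_closedBall]
    · simp
    · simpa using hx.le
  have hχc : HasCompactSupport χ := hb1
  let L : ℕ → (E →L[ℝ] E) := fun n => ((n + 1 : ℝ)⁻¹) • ContinuousLinearMap.id ℝ E
  let c : ℕ → E → ℂ := fun n x => χ (L n x)
  have hLn : ∀ n, ‖L n‖ ≤ 1 := by
    intro n
    refine ContinuousLinearMap.opNorm_le_bound _ zero_le_one (fun x => ?_)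
    simp only [L, smul_apply, ContinuousLinearMap.id_apply, norm_smul]
    gcongr
    rw [Real.norm_of_nonneg (by positivity)]
    apply inv_le_one_of_one_le₀
    have : (0:ℝ) ≤ n := Nat.cast_nonneg n
    linarith
  have hcs : ∀ n, ContDiff ℝ (⊤ : ℕ∞) (c n) := fun n => (χ.smooth ⊤).comp (L n).contDiff
  have hcb : ∀ n i x, ‖iteratedFDeriv ℝ i (c n) x‖ ≤ SchwartzMap.seminorm ℝ 0 i χ := by
    intro n i x
    have h := (L n).iteratedFDeriv_comp_right (f := χ) (χ.smooth ⊤) x (i := i) (by exact_mod_cast le_top)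
    have h' : c n = χ ∘ L n := rfl
    rw [h', h]
    refine (ContinuousMultilinearMap.norm_compContinuousLinearMap_le _ _).trans ?_
    calc _ ≤ SchwartzMap.seminorm ℝ 0 i χ * 1 := by
          gcongr
          · exact SchwartzMap.norm_iteratedFDeriv_le_seminorm ℝ χ i _
          · exact Finset.prod_le_one (fun _ _ => norm_nonneg _) (fun _ _ => hLn n)
      _ = _ := mul_one _
  have hcc : ∀ n, HasCompactSupport (c n) := by
    intro n
    have hne : ((n + 1 : ℝ)⁻¹) ≠ 0 := by positivity
    exact hχc.comp_homeomorph (Homeomorph.smulOfNeZero _ hne)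
  have hpc : ∀ n, HasCompactSupport (fun x => c n x * f x) := fun n => (hcc n).mul_right
  refine ⟨fun n => (hpc n).toSchwartzMap ((hcs n).mul (f.smooth ⊤)), hpc, ?_⟩
  rw [(schwartz_withSeminorms ℝ E ℂ).tendsto_nhds _ f]
  rintro ⟨k, j⟩ ε hε
  set M : ℝ := SchwartzMap.seminorm ℝ (k+1) j f + ∑ i ∈ Finset.range (j+1), (j.choose i : ℝ) *
    SchwartzMap.seminorm ℝ 0 i χ * SchwartzMap.seminorm ℝ (k+1) (j-i) f with hM
  have hM0 : 0 ≤ M := by positivity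
  have key : ∀ n : ℕ, SchwartzMap.seminorm ℝ k j
      ((hpc n).toSchwartzMap ((hcs n).mul (f.smooth ⊤)) - f) ≤ M / (n+1) := by
    intro n
    refine SchwartzMap.seminorm_le_bound ℝ k j _ (by positivity) (fun x => ?_)
    have hfun : ⇑((hpc n).toSchwartzMap ((hcs n).mul (f.smooth ⊤)) - f) =
      fun x => c n x * f x - f x := rfl
    rw [hfun]
    rcases lt_or_ge ‖x‖ (n+1) with hx | hx
    · have : (fun x => c n x * f x - f x) =ᶠ[𝓝 x] (fun _ => 0) := by
        have : ∀ᶠ y in 𝓝 x, ‖y‖ < n+1 := continuous_norm.continuousAt.eventually_lt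
          continuousAt_const hx
        filter_upwards [this] with y hy
        have : c n y = 1 := by
          apply hχ1
          simp only [L, smul_apply, ContinuousLinearMap.id_apply, norm_smul]
          rw [Real.norm_of_nonneg (by positivity), inv_mul_lt_iff₀ (by positivity)]
          simpa using hy
        rw [this]; ring
      rw [(Filter.EventuallyEq.iteratedFDeriv ℝ this j).eq_of_nhds]
      have : iteratedFDeriv ℝ j (fun _ : E => (0:ℂ)) x = 0 := by
        have := iteratedFDeriv_fun_zero (𝕜 := ℝ) (E := E) (F := ℂ) (n := j)
        exact congrFun this x
      rw [this]; simp; positivity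
    · have hsub : iteratedFDeriv ℝ j (fun x => c n x * f x - f x) x =
          iteratedFDeriv ℝ j (fun x => c n x * f x) x - iteratedFDeriv ℝ j f x := by
        have := iteratedFDeriv_sub_apply (𝕜 := ℝ) (i := j) (x := x) (f := fun x => c n x * f x) (g := f)
          ((((hcs n).mul (f.smooth ⊤)).of_le (by exact_mod_cast le_top)).contDiffAt) ((f.smooth j).contDiffAt)
        exact this
      rw [hsub]
      have hprod := norm_iteratedFDeriv_mul_le (𝕜 := ℝ) (hcs n) (f.smooth ⊤) x (n := j)
        (by exact_mod_cast le_top)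
      have hD : ∀ l, ‖x‖ ^ k * ‖iteratedFDeriv ℝ l f x‖ * (n+1) ≤ SchwartzMap.seminorm ℝ (k+1) l f := by
        intro l
        have := SchwartzMap.le_seminorm ℝ (k+1) l f x
        refine le_trans ?_ this
        rw [pow_succ]
        have h0 : 0 ≤ ‖x‖ ^ k * ‖iteratedFDeriv ℝ l f x‖ := by positivity
        nlinarith
      rw [le_div_iff₀ (by positivity)]
      calc _ ≤ ‖x‖ ^ k * (∑ i ∈ Finset.range (j + 1),
              (j.choose i : ℝ) * ‖iteratedFDeriv ℝ i (c n) x‖ * ‖iteratedFDeriv ℝ (j - i) f x‖ +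
              ‖iteratedFDeriv ℝ j f x‖) * (n+1) := by
            gcongr
            exact (norm_sub_le _ _).trans (by gcongr)
        _ = ‖x‖ ^ k * ‖iteratedFDeriv ℝ j f x‖ * (n+1) + ∑ i ∈ Finset.range (j + 1),
              (j.choose i : ℝ) * ‖iteratedFDeriv ℝ i (c n) x‖ * (‖x‖ ^ k * ‖iteratedFDeriv ℝ (j - i) f x‖ * (n+1)) := by
            rw [mul_add (‖x‖ ^ k), add_mul _ _ ((n:ℝ)+1), add_comm, Finset.mul_sum, Finset.sum_mul]
            congr 1
            refine Finset.sum_congr rfl (fun i _ => by ring)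
        _ ≤ M := by
            rw [hM]
            gcongr with i hi
            · exact hD j
            · exact hcb n i x
            · exact hD _
  have hlim : Tendsto (fun n : ℕ => M / ((n:ℝ)+1)) atTop (𝓝 0) :=
    tendsto_const_div_atTop_nhds_zero_nat M |>.comp (tendsto_add_atTop_nat 1) |>.congr (by intro n; simp)
  filter_upwards [hlim.eventually_lt_const hε] with n hn
  exact (key n).trans_lt hn

lemma transRefl_bound (T : SchwartzMap E ℂ →L[ℂ] ℂ) :
    ∃ (N : ℕ) (q : SchwartzMap E ℂ → ℝ), Continuous q ∧ q 0 = 0 ∧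
      ∀ x φ, ‖T (transRefl x φ)‖ ≤ (1 + ‖x‖) ^ N * q φ := by
  obtain ⟨s, C, -, hC⟩ := Seminorm.bound_of_continuous (schwartz_withSeminorms ℂ E ℂ)
    ((normSeminorm ℂ ℂ).comp (T : SchwartzMap E ℂ →ₗ[ℂ] ℂ)) (by
      exact continuous_norm.comp T.continuous)
  let p := schwartzSeminormFamily ℂ E ℂ
  let N := s.sup Prod.fst
  refine ⟨N, fun φ => C * ∑ m ∈ s, 2 ^ m.1 * ∑ i ∈ Finset.Iic m, p i φ, ?_, ?_, ?_⟩
  · have : ∀ i, Continuous (p i) := (schwartz_withSeminorms ℂ E ℂ).continuous_seminorm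
    fun_prop
  · simp
  · intro x φ
    have hbase : (1:ℝ) ≤ 1 + ‖x‖ := by linarith [norm_nonneg x]
    have h1 := hC (transRefl x φ)
    have h2 : ∀ m ∈ s, p m (transRefl x φ) ≤ (1 + ‖x‖) ^ N * (2 ^ m.1 * ∑ i ∈ Finset.Iic m, p i φ) := by
      rintro ⟨k, l⟩ hm
      have hs : (0:ℝ) ≤ ∑ i ∈ Finset.Iic (k,l), p i φ := Finset.sum_nonneg (fun i _ => apply_nonneg _ _)
      refine SchwartzMap.seminorm_le_bound ℂ k l _ (by positivity) (fun y => ?_)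
      have hd : ‖iteratedFDeriv ℝ l (transRefl x φ) y‖ = ‖iteratedFDeriv ℝ l φ (x - y)‖ := by
        have e1 : ⇑(transRefl x φ) = (fun z => φ (x + z)) ∘ (LinearIsometryEquiv.neg ℝ (E := E)) := by
          ext z; simp [sub_eq_add_neg]
        rw [e1, LinearIsometryEquiv.norm_iteratedFDeriv_comp_right, iteratedFDeriv_comp_add_left]
        simp [sub_eq_add_neg]
      rw [hd]
      have h3 := SchwartzMap.one_add_le_sup_seminorm_apply (𝕜 := ℂ) (m := (k,l)) le_rfl le_rfl φ (x - y)
      have h4 : (Finset.Iic (k,l)).sup (fun m => SchwartzMap.seminorm ℂ m.1 m.2) φ ≤ ∑ i ∈ Finset.Iic (k,l), p i φ := by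
        have h := Seminorm.finset_sup_le_sum p (Finset.Iic (k,l)) φ
        have h' : ((Finset.Iic (k,l)).sup p) φ ≤ ∑ i ∈ Finset.Iic (k,l), p i φ := by simpa using h
        exact h'
      have h5 : ‖y‖ ≤ (1 + ‖x‖) * (1 + ‖x - y‖) := by
        have : ‖y‖ ≤ ‖x‖ + ‖x - y‖ := by
          have := norm_sub_le x (x - y); simpa using this
        nlinarith [norm_nonneg x, norm_nonneg (x-y)]
      calc ‖y‖ ^ k * ‖iteratedFDeriv ℝ l φ (x - y)‖ 
          ≤ ((1 + ‖x‖) * (1 + ‖x - y‖)) ^ k * ‖iteratedFDeriv ℝ l φ (x - y)‖ := by gcongr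
        _ = (1 + ‖x‖) ^ k * ((1 + ‖x - y‖) ^ k * ‖iteratedFDeriv ℝ l φ (x - y)‖) := by
            rw [mul_pow]; ring
        _ ≤ (1 + ‖x‖) ^ N * (2 ^ k * ∑ i ∈ Finset.Iic (k,l), p i φ) := by
            have hkN : k ≤ N := Finset.le_sup (f := Prod.fst) hm
            exact mul_le_mul (pow_le_pow_right₀ hbase hkN)
              (h3.trans (mul_le_mul_of_nonneg_left h4 (by positivity))) (by positivity)
              (by positivity)
    have hnn : ∀ m, (0:ℝ) ≤ ∑ i ∈ Finset.Iic m, p i φ := 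
      fun m => Finset.sum_nonneg (fun i _ => apply_nonneg _ _)
    calc ‖T (transRefl x φ)‖ ≤ C * (s.sup p) (transRefl x φ) := h1
      _ ≤ C * ∑ m ∈ s, p m (transRefl x φ) := by
          gcongr
          have := Seminorm.finset_sup_le_sum p s (transRefl x φ)
          simpa using this
      _ ≤ C * ∑ m ∈ s, (1 + ‖x‖) ^ N * (2 ^ m.1 * ∑ i ∈ Finset.Iic m, p i φ) := by
          gcongr with m hm
          exact h2 m hm
      _ = _ := by rw [← Finset.mul_sum]; ring

end Pieces

section Pieces2

variable {E : Type*} [NormedAddCommGroup E] [InnerProductSpace ℝ E] [FiniteDimensional ℝ E]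
  [MeasurableSpace E] [BorelSpace E]

/-- The character `ξ ↦ e^{2πi⟨t,ξ⟩}`. -/
def chr (t ξ : E) : ℂ := Complex.exp (((2 * Real.pi * (inner ℝ t ξ : ℝ) : ℝ) : ℂ) * Complex.I)

lemma norm_chr (t ξ : E) : ‖chr t ξ‖ = 1 := by
  unfold chr; exact Complex.norm_exp_ofReal_mul_I _

lemma continuous_chr : Continuous (fun p : E × E => chr p.1 p.2) := by
  unfold chr; fun_prop

lemma chr_add_left (s t ξ : E) : chr (s + t) ξ = chr s ξ * chr t ξ := by
  unfold chr
  rw [← Complex.exp_add, inner_add_left]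
  congr 1
  push_cast; ring

lemma chr_sub_right (t ξ η : E) : chr t (ξ - η) = chr t ξ * conj (chr t η) := by
  unfold chr
  rw [← Complex.exp_conj, ← Complex.exp_add, inner_sub_right]
  congr 1
  simp only [map_mul, Complex.conj_ofReal, Complex.conj_I]
  push_cast; ring

lemma norm_chr_sub_le (s t ξ : E) : ‖chr s ξ - chr t ξ‖ ≤ 2 * Real.pi * ‖s - t‖ * ‖ξ‖ := by
  have h1 : chr s ξ - chr t ξ = (chr (s - t) ξ - 1) * chr t ξ := by
    rw [sub_mul, ← chr_add_left]; simp
  rw [h1, norm_mul, norm_chr, mul_one]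
  have h2 := Real.norm_exp_I_mul_ofReal_sub_one_le (x := 2 * Real.pi * (inner ℝ (s - t) ξ : ℝ))
  rw [mul_comm Complex.I] at h2
  refine h2.trans ?_
  rw [norm_mul, Real.norm_of_nonneg (by positivity), mul_assoc (2 * Real.pi)]
  exact mul_le_mul_of_nonneg_left (norm_inner_le_norm (𝕜 := ℝ) (s - t) ξ) (by positivity)

lemma continuous_chr_right (t : E) : Continuous (chr t) :=
  continuous_chr.comp (Continuous.prodMk_right t)

lemma gauss_mean_bound (m : Measure E) [SFinite m] (v : E → ℂ) (hv : Integrable v m)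
    (n : ℕ) (s : E) :
    ∫ x, ‖∫ ξ, chr ((n : ℝ) • x + s) ξ * v ξ ∂m‖ ^ 2 ∂(ProbabilityTheory.stdGaussian E) ≤
      ∫ p : E × E, ‖v p.1‖ * ‖v p.2‖ * Real.exp (-‖(2 * Real.pi * n) • (p.1 - p.2)‖ ^ 2 / 2)
        ∂(m.prod m) := by
  set γ := ProbabilityTheory.stdGaussian E
  set V : E × E → ℂ := fun p => v p.1 * conj (v p.2) with hV
  have hvc : Integrable (fun ξ => conj (v ξ)) m := by
    exact (LinearIsometryEquiv.integrable_comp_iff Complex.conjLIE).2 hv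
  have hVi : Integrable V (m.prod m) := hv.mul_prod hvc
  have hsq : ∀ y : E, ((‖∫ ξ, chr y ξ * v ξ ∂m‖ ^ 2 : ℝ) : ℂ) =
      ∫ p, chr y (p.1 - p.2) * V p ∂(m.prod m) := by
    intro y
    rw [← Complex.normSq_eq_norm_sq, Complex.normSq_eq_conj_mul_self, mul_comm, ← integral_conj,
      ← integral_prod_mul]
    congr 1; ext p
    simp only [hV, map_mul, chr_sub_right]; ring
  have hin : ∀ p : E × E, ∫ x, chr ((n : ℝ) • x + s) (p.1 - p.2) * V p ∂γ =
      (chr s (p.1 - p.2) * V p) * (Real.exp (-‖(2 * Real.pi * n) • (p.1 - p.2)‖ ^ 2 / 2) : ℝ) := by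
    intro p
    have h := ProbabilityTheory.charFun_stdGaussian (E := E) ((2 * Real.pi * n) • (p.1 - p.2))
    rw [charFun_apply] at h
    have h2 : ∀ x : E, chr ((n : ℝ) • x + s) (p.1 - p.2) * V p = (chr s (p.1 - p.2) * V p) *
        Complex.exp ((inner ℝ x ((2 * Real.pi * n) • (p.1 - p.2)) : ℝ) * Complex.I) := by
      intro x
      rw [chr_add_left]
      have : chr ((n:ℝ) • x) (p.1 - p.2) =
          Complex.exp ((inner ℝ x ((2 * Real.pi * n) • (p.1 - p.2)) : ℝ) * Complex.I) := by
        unfold chr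
        rw [real_inner_smul_left, real_inner_smul_right]
        congr 2; push_cast; ring
      rw [this]; ring
    simp_rw [h2]
    rw [integral_const_mul, h]
    push_cast; rfl
  have hInteg : Integrable (Function.uncurry fun (x : E) (p : E × E) =>
      chr ((n : ℝ) • x + s) (p.1 - p.2) * V p) (γ.prod (m.prod m)) := by
    have h1 : Integrable (fun z : E × (E × E) => V z.2) (γ.prod (m.prod m)) := hVi.comp_snd γ
    refine h1.bdd_mul (c := 1) ?_ ?_
    · have : Continuous (fun z : E × (E × E) => chr ((n : ℝ) • z.1 + s) (z.2.1 - z.2.2)) :=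
        continuous_chr.comp (f := fun z : E × (E × E) => ((n : ℝ) • z.1 + s, z.2.1 - z.2.2))
          (by fun_prop)
      exact this.aestronglyMeasurable
    · exact Eventually.of_forall (fun z => (norm_chr _ _).le)
  have hcalc : ((∫ x, ‖∫ ξ, chr ((n : ℝ) • x + s) ξ * v ξ ∂m‖ ^ 2 ∂γ : ℝ) : ℂ) =
      ∫ p : E × E, (chr s (p.1 - p.2) * V p) *
        (Real.exp (-‖(2 * Real.pi * n) • (p.1 - p.2)‖ ^ 2 / 2) : ℝ) ∂(m.prod m) := by
    rw [← integral_complex_ofReal]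
    simp_rw [hsq]
    rw [integral_integral_swap hInteg]
    simp_rw [hin]
  have hnn : 0 ≤ ∫ x, ‖∫ ξ, chr ((n : ℝ) • x + s) ξ * v ξ ∂m‖ ^ 2 ∂γ :=
    integral_nonneg (fun x => by positivity)
  have hnorm : ∫ x, ‖∫ ξ, chr ((n : ℝ) • x + s) ξ * v ξ ∂m‖ ^ 2 ∂γ =
      ‖((∫ x, ‖∫ ξ, chr ((n : ℝ) • x + s) ξ * v ξ ∂m‖ ^ 2 ∂γ : ℝ) : ℂ)‖ := by
    rw [Complex.norm_real, Real.norm_of_nonneg hnn]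
  rw [hnorm, hcalc]
  refine (norm_integral_le_integral_norm _).trans (le_of_eq ?_)
  congr 1; ext p
  rw [norm_mul, norm_mul, norm_chr, one_mul, Complex.norm_real, Real.norm_of_nonneg (Real.exp_pos _).le,
    hV, norm_mul, RCLike.norm_conj]

lemma gauss_kernel_tendsto (m : Measure E) [SFinite m] (hm : ∀ x, m {x} = 0) (v : E → ℂ)
    (hv : Integrable v m) :
    Tendsto (fun n : ℕ => ∫ p : E × E, ‖v p.1‖ * ‖v p.2‖ *
      Real.exp (-‖(2 * Real.pi * n) • (p.1 - p.2)‖ ^ 2 / 2) ∂(m.prod m)) atTop (𝓝 0) := by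
  have hb : Integrable (fun p : E × E => ‖v p.1‖ * ‖v p.2‖) (m.prod m) := hv.norm.mul_prod hv.norm
  have hdiag : ∀ᵐ p ∂(m.prod m), p.1 ≠ p.2 := by
    have : (m.prod m) (Set.diagonal E) = 0 := by
      rw [Measure.measure_prod_null measurableSet_diagonal]
      refine Eventually.of_forall (fun x => ?_)
      have : Prod.mk x ⁻¹' Set.diagonal E = {x} := by ext y; simp [eq_comm]
      simp [this, hm]
    rw [ae_iff]
    convert this using 2
    ext p; simp
  have := tendsto_integral_of_dominated_convergence (μ := m.prod m)
    (F := fun n : ℕ => fun p : E × E => ‖v p.1‖ * ‖v p.2‖ *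
      Real.exp (-‖(2 * Real.pi * n) • (p.1 - p.2)‖ ^ 2 / 2)) (f := fun _ => 0)
    (fun p => ‖v p.1‖ * ‖v p.2‖) ?_ hb ?_ ?_
  · simpa using this
  · intro n
    refine hb.aestronglyMeasurable.mul (Continuous.aestronglyMeasurable ?_)
    fun_prop
  · intro n
    refine Eventually.of_forall (fun p => ?_)
    rw [Real.norm_of_nonneg (by positivity)]
    refine mul_le_of_le_one_right (by positivity) ?_
    rw [Real.exp_le_one_iff]
    have : 0 ≤ ‖(2 * Real.pi * n) • (p.1 - p.2)‖ ^ 2 := by positivity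
    linarith
  · filter_upwards [hdiag] with p hp
    have hpos : 0 < ‖p.1 - p.2‖ := norm_pos_iff.2 (sub_ne_zero.2 hp)
    rw [← mul_zero (‖v p.1‖ * ‖v p.2‖)]
    refine Tendsto.const_mul _ (Real.tendsto_exp_atBot.comp ?_)
    have h1 : ∀ n : ℕ, -‖(2 * Real.pi * n) • (p.1 - p.2)‖ ^ 2 / 2 =
        -((2 * Real.pi ^ 2 * ‖p.1 - p.2‖ ^ 2) * (n:ℝ) ^ 2) := by
      intro n
      rw [norm_smul, Real.norm_of_nonneg (by positivity)]; ring
    simp_rw [h1]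
    rw [tendsto_neg_atBot_iff]
    refine Tendsto.const_mul_atTop (by positivity) ?_
    exact (tendsto_pow_atTop two_ne_zero).comp tendsto_natCast_atTop_atTop

lemma exists_small (m : Measure E) [SFinite m] (hm : ∀ x, m {x} = 0) (v : E → ℂ)
    (hv : Integrable v m) (hv' : Integrable (fun ξ => ‖ξ‖ * ‖v ξ‖) m) (P : Set E)
    (hP : IsRelativelyDense P) (ε : ℝ) (hε : 0 < ε) :
    ∃ t ∈ P, ‖∫ ξ, chr t ξ * v ξ ∂m‖ < ε := by
  by_contra! hcon
  set F : E → ℂ := fun t => ∫ ξ, chr t ξ * v ξ ∂m with hF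
  have hInteg : ∀ t, Integrable (fun ξ => chr t ξ * v ξ) m := fun t =>
    hv.bdd_mul (c := 1) (continuous_chr_right t).aestronglyMeasurable
      (Eventually.of_forall (fun z => (norm_chr _ _).le))
  set K : ℝ := 2 * Real.pi * ∫ ξ, ‖ξ‖ * ‖v ξ‖ ∂m with hK
  have hK0 : 0 ≤ K := by
    have : 0 ≤ ∫ ξ, ‖ξ‖ * ‖v ξ‖ ∂m := integral_nonneg (fun _ => by positivity)
    positivity
  have hLip : ∀ s t, ‖F s - F t‖ ≤ K * ‖s - t‖ := by
    intro s t
    rw [hF]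
    simp only
    rw [← integral_sub (hInteg s) (hInteg t)]
    have h1 : ∀ᵐ ξ ∂m, ‖chr s ξ * v ξ - chr t ξ * v ξ‖ ≤ 2 * Real.pi * ‖s - t‖ * (‖ξ‖ * ‖v ξ‖) := by
      refine Eventually.of_forall (fun ξ => ?_)
      rw [← sub_mul, norm_mul, ← mul_assoc]
      gcongr
      exact norm_chr_sub_le s t ξ
    refine (norm_integral_le_of_norm_le (hv'.const_mul _) h1).trans (le_of_eq ?_)
    rw [integral_const_mul, hK]; ring
  have hFc : Continuous F := by
    have : LipschitzWith ⟨K, hK0⟩ F := LipschitzWith.of_dist_le_mul (fun s t => by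
      rw [dist_eq_norm, dist_eq_norm]; exact hLip s t)
    exact this.continuous
  have hFb : ∀ t, ‖F t‖ ≤ ∫ ξ, ‖v ξ‖ ∂m := by
    intro t
    refine (norm_integral_le_integral_norm _).trans (le_of_eq ?_)
    congr 1; ext ξ; rw [norm_mul, norm_chr, one_mul]
  obtain ⟨r, hr⟩ := hP
  set δ : ℝ := ε / (2 * (K + 1)) with hδ
  have hδ0 : 0 < δ := by positivity
  obtain ⟨net, -, hfin, hcov⟩ := (isCompact_closedBall (0:E) r).finite_cover_balls hδ0
  have hlow : ∀ y, ε ^ 2 / 4 ≤ ∑ s ∈ hfin.toFinset, ‖F (y + s)‖ ^ 2 := by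
    intro y
    obtain ⟨a, haP, ha⟩ := hr y
    have hmem : a - y ∈ closedBall (0:E) r := by
      rw [mem_closedBall_zero_iff, ← dist_eq_norm, dist_comm]; exact ha
    obtain ⟨s, hs, hs'⟩ := Set.mem_iUnion₂.1 (hcov hmem)
    have h1 : ‖F a - F (y + s)‖ ≤ ε / 2 := by
      refine (hLip _ _).trans ?_
      have : ‖a - (y + s)‖ ≤ δ := by
        rw [mem_ball, dist_eq_norm] at hs'
        rw [← sub_sub]; exact hs'.le
      calc K * ‖a - (y+s)‖ ≤ (K+1) * δ := by gcongr; linarith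
        _ = ε / 2 := by rw [hδ]; field_simp
    have h2 : ε / 2 ≤ ‖F (y + s)‖ := by
      have h3 := hcon a haP
      have h4 := norm_sub_norm_le (F a) (F (y+s))
      have h3' : ε ≤ ‖F a‖ := h3
      linarith
    calc ε ^ 2 / 4 = (ε/2)^2 := by ring
      _ ≤ ‖F (y + s)‖ ^ 2 := by gcongr
      _ ≤ _ := Finset.single_le_sum (f := fun s => ‖F (y + s)‖ ^ 2) (fun _ _ => by positivity)
        (hfin.mem_toFinset.2 hs)
  set A : ℕ → ℝ := fun n : ℕ => ∫ p : E × E, ‖v p.1‖ * ‖v p.2‖ *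
      Real.exp (-‖(2 * Real.pi * n) • (p.1 - p.2)‖ ^ 2 / 2) ∂(m.prod m) with hA
  have hA0 : Tendsto A atTop (𝓝 0) := gauss_kernel_tendsto m hm v hv
  have hle : ∀ n : ℕ, ε ^ 2 / 4 ≤ hfin.toFinset.card * A n := by
    intro n
    have hI : ∀ s ∈ hfin.toFinset, Integrable (fun x : E => ‖F ((n:ℝ) • x + s)‖ ^ 2)
        (ProbabilityTheory.stdGaussian E) := by
      intro s _
      refine Integrable.of_bound (C := (∫ ξ, ‖v ξ‖ ∂m) ^ 2) ?_ (Eventually.of_forall fun x => ?_)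
      · exact Continuous.aestronglyMeasurable (by fun_prop)
      · rw [Real.norm_of_nonneg (by positivity)]
        gcongr
        exact hFb _
    calc ε ^ 2 / 4 = ∫ x : E, ε ^ 2 / 4 ∂(ProbabilityTheory.stdGaussian E) := by simp
      _ ≤ ∫ x : E, ∑ s ∈ hfin.toFinset, ‖F ((n:ℝ) • x + s)‖ ^ 2
            ∂(ProbabilityTheory.stdGaussian E) :=
          integral_mono (integrable_const _) (integrable_finsetSum _ hI) (fun x => hlow _)
      _ = ∑ s ∈ hfin.toFinset, ∫ x : E, ‖F ((n:ℝ) • x + s)‖ ^ 2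
            ∂(ProbabilityTheory.stdGaussian E) := integral_finsetSum _ hI
      _ ≤ ∑ s ∈ hfin.toFinset, A n :=
          Finset.sum_le_sum (fun s _ => gauss_mean_bound m v hv n s)
      _ = _ := by simp
  have hlim : Tendsto (fun n => (hfin.toFinset.card : ℝ) * A n) atTop (𝓝 0) := by
    simpa using hA0.const_mul (hfin.toFinset.card : ℝ)
  have := ge_of_tendsto' hlim hle
  have : 0 < ε ^ 2 / 4 := by positivity
  linarith

end Pieces2

section Pieces3

open scoped FourierTransform

variable {E : Type*} [NormedAddCommGroup E] [InnerProductSpace ℝ E] [FiniteDimensional ℝ E]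
  [MeasurableSpace E] [BorelSpace E]

lemma contDiff_chr (t : E) : ContDiff ℝ (⊤ : ℕ∞) (chr t) := by
  unfold chr
  have : ContDiff ℝ (⊤ : ℕ∞) (fun ξ : E => ((2 * Real.pi * (inner ℝ t ξ : ℝ) : ℝ) : ℂ)) :=
    Complex.ofRealCLM.contDiff.comp (contDiff_const.mul (contDiff_const.inner ℝ contDiff_id))
  exact (this.mul contDiff_const).cexp

lemma conv_test (T : SchwartzMap E ℂ →L[ℂ] ℂ) (μ : CMeasure E) (hAg : μ.Agrees (fourierTD T))
    (φ : SchwartzMap E ℂ) (hφ : HasCompactSupport φ) (x : E) :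
    convTD T (𝓕⁻ φ) x = ∫ ξ, chr x ξ * (φ ξ * μ.density ξ) ∂μ.tv := by
  have hc : HasCompactSupport (fun ξ => chr x ξ * φ ξ) := hφ.mul_left
  let ψ : SchwartzMap E ℂ := hc.toSchwartzMap ((contDiff_chr x).mul (φ.smooth ⊤))
  have h1 : 𝓕 ψ = transRefl x (𝓕⁻ φ) := by
    ext y
    rw [transRefl_apply, SchwartzMap.fourier_coe, SchwartzMap.fourierInv_coe, Real.fourier_eq',
      Real.fourierInv_eq']
    congr 1; ext ξ
    have : ψ ξ = chr x ξ * φ ξ := rfl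
    rw [this, smul_eq_mul, smul_eq_mul, ← mul_assoc]
    congr 1
    unfold chr
    rw [← Complex.exp_add, inner_sub_right, real_inner_comm x ξ, real_inner_comm y ξ]
    congr 1
    push_cast; ring
  have h2 := hAg ψ hc
  unfold convTD
  rw [← h1]
  have h3 : T (𝓕 ψ) = fourierTD T ψ := rfl
  rw [h3, h2]
  unfold CMeasure.pairing
  congr 1; ext ξ
  exact mul_assoc _ _ _

lemma integrable_test (μ : CMeasure E) (φ : E → ℂ) (hc : Continuous φ) (hφ : HasCompactSupport φ) :
    Integrable (fun ξ => φ ξ * μ.density ξ) μ.tv := by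
  have := μ.locFin
  have h := hc.integrable_of_hasCompactSupport hφ (μ := μ.tv)
  refine h.mul_bdd (c := 1) μ.density_meas.aestronglyMeasurable ?_
  filter_upwards [μ.density_norm] with x hx using hx.le

lemma conv_test_fubini (T : SchwartzMap E ℂ →L[ℂ] ℂ) (μ : CMeasure E) (hAg : μ.Agrees (fourierTD T))
    (k φ : SchwartzMap E ℂ) (hφ : HasCompactSupport φ) (t : E) :
    ∫ s, k s * convTD T (𝓕⁻ φ) (t - s) =
      ∫ ξ, chr t ξ * 𝓕 k ξ * φ ξ * μ.density ξ ∂μ.tv := by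
  have := μ.locFin
  simp_rw [conv_test T μ hAg φ hφ, ← integral_const_mul]
  rw [integral_integral_swap]
  · congr 1; ext ξ
    rw [SchwartzMap.fourier_coe, Real.fourier_eq', ← integral_const_mul, ← integral_mul_const,
      ← integral_mul_const]
    congr 1; ext s
    have : chr (t - s) ξ = chr t ξ * Complex.exp ((↑(-2 * Real.pi * (inner ℝ s ξ : ℝ)) * Complex.I)) := by
      rw [sub_eq_add_neg, chr_add_left]
      congr 1
      unfold chr
      rw [inner_neg_left]; congr 2; push_cast; ring
    rw [this, smul_eq_mul]; ring
  · have h1 : Integrable (fun z : E × E => k z.1 * (φ z.2 * μ.density z.2)) (volume.prod μ.tv) :=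
      k.integrable.mul_prod (integrable_test μ φ φ.continuous hφ)
    have h2 : Integrable (fun z : E × E => chr (t - z.1) z.2 * (k z.1 * (φ z.2 * μ.density z.2)))
        (volume.prod μ.tv) := by
      refine h1.bdd_mul (c := 1) ?_ (Eventually.of_forall (fun z => (norm_chr _ _).le))
      have : Continuous (fun z : E × E => chr (t - z.1) z.2) :=
        continuous_chr.comp (f := fun z : E × E => (t - z.1, z.2)) (by fun_prop)
      exact this.aestronglyMeasurable
    refine h2.congr (Eventually.of_forall fun z => ?_)
    simp only [Function.uncurry]; ring

lemma continuous_conv_test (T : SchwartzMap E ℂ →L[ℂ] ℂ) (μ : CMeasure E)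
    (hAg : μ.Agrees (fourierTD T)) (φ : SchwartzMap E ℂ) (hφ : HasCompactSupport φ) :
    Continuous (convTD T (𝓕⁻ φ)) := by
  have : convTD T (𝓕⁻ φ) = fun x => ∫ ξ, chr x ξ * (φ ξ * μ.density ξ) ∂μ.tv :=
    funext (conv_test T μ hAg φ hφ)
  rw [this]
  have hi := integrable_test μ φ φ.continuous hφ
  refine continuous_of_dominated (bound := fun ξ => ‖φ ξ * μ.density ξ‖) ?_ ?_ hi.norm ?_
  · exact fun x => (continuous_chr_right x).aestronglyMeasurable.mul hi.aestronglyMeasurable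
  · exact fun x => Eventually.of_forall fun ξ => by rw [norm_mul, norm_chr, one_mul]
  · refine Eventually.of_forall fun ξ => ?_
    exact (continuous_chr.comp (Continuous.prodMk_left ξ)).mul continuous_const

lemma key_identity (T : SchwartzMap E ℂ →L[ℂ] ℂ) (μ : CMeasure E) (hAg : μ.Agrees (fourierTD T))
    (k f : SchwartzMap E ℂ) (hk : HasCompactSupport (𝓕 k : SchwartzMap E ℂ)) (t : E) :
    ∫ s, k s * convTD T f (t - s) =
      ∫ ξ, chr t ξ * 𝓕 k ξ * 𝓕 f ξ * μ.density ξ ∂μ.tv := by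
  have := μ.locFin
  obtain ⟨φ, hφc, hφ⟩ := exists_test_tendsto (𝓕 f)
  have hf : Tendsto (fun n => 𝓕⁻ (φ n)) atTop (𝓝 f) := by
    have h := (FourierTransform.continuous_fourierInv (E := SchwartzMap E ℂ)
      (F := SchwartzMap E ℂ)).tendsto (𝓕 f) |>.comp hφ
    simpa [Function.comp_def] using h
  obtain ⟨N, q, hqc, hq0, hq⟩ := transRefl_bound T
  have hL : Tendsto (fun n => ∫ s, k s * convTD T (𝓕⁻ (φ n)) (t - s)) atTop
      (𝓝 (∫ s, k s * convTD T f (t - s))) := by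
    have hqt : Tendsto (fun n => q (𝓕⁻ (φ n))) atTop (𝓝 (q f)) := (hqc.tendsto f).comp hf
    obtain ⟨B, hB⟩ := hqt.bddAbove_range
    have hB' : ∀ n, q (𝓕⁻ (φ n)) ≤ B := fun n => hB ⟨n, rfl⟩
    have hInteg : Integrable (fun s => (1 + ‖t‖) ^ N * B * (2 ^ N * (‖k s‖ + ‖s‖ ^ N * ‖k s‖))) := by
      exact ((k.integrable.norm.add (k.integrable_pow_mul volume N)).const_mul _).const_mul _
    have hB0 : 0 ≤ B := by
      have h := hq 0 (𝓕⁻ (φ 0))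
      have h2 : 0 ≤ q (𝓕⁻ (φ 0)) := by
        have := (norm_nonneg _).trans h
        simpa using this
      exact h2.trans (hB' 0)
    refine tendsto_integral_of_dominated_convergence _ ?_ hInteg ?_ ?_
    · intro n
      have := continuous_conv_test T μ hAg (φ n) (hφc n)
      exact (k.continuous.mul (this.comp (continuous_const.sub continuous_id))).aestronglyMeasurable
    · intro n
      refine Eventually.of_forall fun s => ?_
      rw [norm_mul]
      have h1 : ‖convTD T (𝓕⁻ (φ n)) (t - s)‖ ≤ (1 + ‖t - s‖) ^ N * B :=
        (hq _ _).trans (by gcongr; exact hB' n)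
      have h2 : 1 + ‖t - s‖ ≤ (1 + ‖t‖) * (1 + ‖s‖) := by
        have := norm_sub_le t s
        nlinarith [norm_nonneg t, norm_nonneg s]
      have h3 : (1 + ‖s‖) ^ N ≤ 2 ^ N * (1 + ‖s‖ ^ N) := by
        have h4 : 1 + ‖s‖ ≤ 2 * max 1 ‖s‖ := by
          have := le_max_left 1 ‖s‖
          have := le_max_right 1 ‖s‖
          linarith
        calc (1 + ‖s‖) ^ N ≤ (2 * max 1 ‖s‖) ^ N := by gcongr
          _ = 2 ^ N * (max 1 ‖s‖) ^ N := mul_pow _ _ _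
          _ ≤ _ := by
            gcongr
            rcases max_cases 1 ‖s‖ with ⟨h, _⟩ | ⟨h, _⟩ <;> rw [h]
            · rw [one_pow]; linarith [pow_nonneg (norm_nonneg s) N]
            · linarith
      calc ‖k s‖ * ‖convTD T (𝓕⁻ (φ n)) (t - s)‖
          ≤ ‖k s‖ * (((1 + ‖t‖) * (1 + ‖s‖)) ^ N * B) := by
            gcongr
            exact h1.trans (by gcongr)
        _ = ‖k s‖ * ((1 + ‖t‖) ^ N * (1 + ‖s‖) ^ N * B) := by rw [mul_pow]
        _ ≤ ‖k s‖ * ((1 + ‖t‖) ^ N * (2 ^ N * (1 + ‖s‖ ^ N)) * B) := by gcongr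
        _ = _ := by ring
    · refine Eventually.of_forall fun s => Tendsto.const_mul _ ?_
      have hc : Continuous (fun ψ : SchwartzMap E ℂ => T (transRefl (t - s) ψ)) :=
        T.continuous.comp (SchwartzMap.compCLMOfAntilipschitz (K := 1) ℝ
          (hasTemperateGrowth_const_sub (t - s)) (isometry_const_sub (t - s)).antilipschitz).continuous
      exact (hc.tendsto f).comp hf
  have hR : Tendsto (fun n => ∫ ξ, chr t ξ * 𝓕 k ξ * φ n ξ * μ.density ξ ∂μ.tv) atTop
      (𝓝 (∫ ξ, chr t ξ * 𝓕 k ξ * 𝓕 f ξ * μ.density ξ ∂μ.tv)) := by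
    have hp : Continuous (SchwartzMap.seminorm ℂ 0 0 : Seminorm ℂ (SchwartzMap E ℂ)) :=
      (schwartz_withSeminorms ℂ E ℂ).continuous_seminorm (0, 0)
    obtain ⟨B, hB⟩ := ((hp.tendsto (𝓕 f)).comp hφ).bddAbove_range
    have hB' : ∀ n, SchwartzMap.seminorm ℂ 0 0 (φ n) ≤ B := fun n => hB ⟨n, rfl⟩
    have hB0 : 0 ≤ B := (apply_nonneg _ _).trans (hB' 0)
    have hki : Integrable (𝓕 k : SchwartzMap E ℂ) μ.tv :=
      (𝓕 k : SchwartzMap E ℂ).continuous.integrable_of_hasCompactSupport hk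
    refine tendsto_integral_of_dominated_convergence (fun ξ => ‖𝓕 k ξ‖ * B) ?_
      (hki.norm.mul_const B) ?_ ?_
    · intro n
      exact (((continuous_chr_right t).mul (𝓕 k : SchwartzMap E ℂ).continuous).mul
        (φ n).continuous).aestronglyMeasurable.mul μ.density_meas.aestronglyMeasurable
    · intro n
      filter_upwards [μ.density_norm] with ξ hξ
      rw [norm_mul, hξ, mul_one, norm_mul, norm_mul, norm_chr, one_mul]
      gcongr
      exact ((φ n).norm_le_seminorm ℂ ξ).trans (hB' n)
    · refine Eventually.of_forall fun ξ => Tendsto.mul_const _ (Tendsto.const_mul _ ?_)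
      rw [tendsto_iff_norm_sub_tendsto_zero]
      have hz : Tendsto (fun n => SchwartzMap.seminorm ℂ 0 0 (φ n - 𝓕 f)) atTop (𝓝 0) := by
        have h0 : Tendsto (fun n => φ n - 𝓕 f) atTop (𝓝 0) := by
          simpa using hφ.sub_const (𝓕 f)
        have := (hp.tendsto 0).comp h0
        simpa [Function.comp_def] using this
      refine squeeze_zero (fun _ => norm_nonneg _) (fun n => ?_) hz
      exact (φ n - 𝓕 f).norm_le_seminorm ℂ ξ
  refine tendsto_nhds_unique hL (hR.congr fun n => ?_)
  exact (conv_test_fubini T μ hAg k (φ n) (hφc n) t).symm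

end Pieces3

section Pieces4

open scoped FourierTransform

variable {E : Type*} [NormedAddCommGroup E] [InnerProductSpace ℝ E] [FiniteDimensional ℝ E]
  [MeasurableSpace E] [BorelSpace E]

lemma test_ineq (T : SchwartzMap E ℂ →L[ℂ] ℂ) (μ : CMeasure E) (hAg : μ.Agrees (fourierTD T))
    (f : SchwartzMap E ℂ) (hf : IsBohrAP (convTD T f)) (S : Set E) (hS : MeasurableSet S)
    (hat : ∀ x ∉ S, μ.tv {x} = 0) (u : SchwartzMap E ℂ) (hu : HasCompactSupport u) :
    ‖∫ ξ, u ξ * 𝓕 f ξ * μ.density ξ ∂μ.tv‖ ≤ ∫ ξ in S, ‖u ξ‖ * ‖𝓕 f ξ‖ ∂μ.tv := by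
  have := μ.locFin
  obtain ⟨k, hku⟩ : ∃ k : SchwartzMap E ℂ, 𝓕 k = u := ⟨𝓕⁻ u, by simp⟩
  have hk : HasCompactSupport (𝓕 k : SchwartzMap E ℂ) := by rw [hku]; exact hu
  obtain ⟨hgu, ⟨C, hC⟩, hap⟩ := hf
  set g := convTD T f with hg
  set v : E → ℂ := fun ξ => u ξ * 𝓕 f ξ * μ.density ξ with hv
  have hw : Continuous (fun ξ => u ξ * 𝓕 f ξ) := u.continuous.mul (𝓕 f : SchwartzMap E ℂ).continuous
  have hwc : HasCompactSupport (fun ξ => u ξ * 𝓕 f ξ) := hu.mul_right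
  have hvi : Integrable v μ.tv := integrable_test μ _ hw hwc
  have hvi' : Integrable (fun ξ => ‖ξ‖ * ‖v ξ‖) μ.tv := by
    have h1 : Integrable (fun ξ => ((‖ξ‖ : ℝ) : ℂ) * (u ξ * 𝓕 f ξ) * μ.density ξ) μ.tv := by
      refine integrable_test μ (fun ξ => ((‖ξ‖ : ℝ) : ℂ) * (u ξ * 𝓕 f ξ)) ?_ ?_
      · exact (Complex.continuous_ofReal.comp continuous_norm).mul hw
      · exact hwc.mul_left
    refine h1.norm.congr (Eventually.of_forall fun ξ => ?_)
    simp [hv, mul_assoc]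
  have hF : ∀ t, ∫ ξ, chr t ξ * v ξ ∂μ.tv = ∫ s, k s * g (t - s) := by
    intro t
    rw [hg, key_identity T μ hAg k f hk t, hku]
    congr 1; ext ξ; simp only [hv]; ring
  have hki : Integrable k := k.integrable
  have hgi : ∀ t, Integrable (fun s => k s * g (t - s)) := fun t =>
    hki.mul_bdd (c := C) ((hgu.continuous.comp
      (continuous_const.sub continuous_id)).aestronglyMeasurable) (Eventually.of_forall fun s => hC _)
  have hchi : ∀ t, Integrable (fun ξ => chr t ξ * v ξ) μ.tv := fun t =>
    hvi.bdd_mul (c := 1) (continuous_chr_right t).aestronglyMeasurable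
      (Eventually.of_forall fun z => (norm_chr _ _).le)
  have hF0 : ∫ ξ, chr 0 ξ * v ξ ∂μ.tv = ∫ ξ, v ξ ∂μ.tv := by
    congr 1; ext ξ; simp [chr]
  rw [← hF0]
  have hvn : ∀ᵐ ξ ∂μ.tv, ‖v ξ‖ = ‖u ξ‖ * ‖𝓕 f ξ‖ := by
    filter_upwards [μ.density_norm] with ξ hξ
    simp only [hv, norm_mul, hξ, mul_one]
  have main : ∀ ε : ℝ, 0 < ε → ‖∫ ξ, chr 0 ξ * v ξ ∂μ.tv‖ ≤
      (∫ ξ in S, ‖u ξ‖ * ‖𝓕 f ξ‖ ∂μ.tv) + ε * (1 + ∫ s, ‖k s‖) := by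
    intro ε hε
    obtain ⟨r, hr⟩ := hap ε hε
    have hP : IsRelativelyDense {t : E | ∀ x, ‖g (x + t) - g x‖ < ε} := by
      refine ⟨r, fun x => ?_⟩
      obtain ⟨a, ha, hxa⟩ := hr (-x)
      refine ⟨-a, fun y => ?_, ?_⟩
      · simpa [sub_eq_add_neg] using ha y
      · rw [← dist_neg_neg]; simpa using hxa
    have hm : ∀ x, (μ.tv.restrict Sᶜ) {x} = 0 := by
      intro x
      rw [Measure.restrict_apply (measurableSet_singleton x)]
      by_cases hx : x ∈ S
      · have : ({x} : Set E) ∩ Sᶜ = ∅ := by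
          ext y; simp only [Set.mem_inter_iff, Set.mem_singleton_iff, Set.mem_compl_iff,
            Set.mem_empty_iff_false, iff_false, not_and, not_not]
          rintro rfl; exact hx
        rw [this, measure_empty]
      · exact measure_mono_null Set.inter_subset_left (hat x hx)
    obtain ⟨t, ht, hts⟩ := exists_small (μ.tv.restrict Sᶜ) hm v hvi.restrict hvi'.restrict _ hP ε hε
    have h1 : ‖(∫ ξ, chr t ξ * v ξ ∂μ.tv) - ∫ ξ, chr 0 ξ * v ξ ∂μ.tv‖ ≤ ε * ∫ s, ‖k s‖ := by
      rw [hF, hF, ← integral_sub (hgi t) (hgi 0), ← integral_const_mul]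
      refine norm_integral_le_of_norm_le (hki.norm.const_mul ε) (Eventually.of_forall fun s => ?_)
      rw [← mul_sub, norm_mul, mul_comm]
      gcongr
      have := ht (-s)
      have e1 : t - s = -s + t := by abel
      rw [e1, zero_sub]; exact this.le
    have h2 : ‖∫ ξ, chr t ξ * v ξ ∂μ.tv‖ ≤ (∫ ξ in S, ‖u ξ‖ * ‖𝓕 f ξ‖ ∂μ.tv) + ε := by
      rw [← integral_add_compl hS (hchi t)]
      refine (norm_add_le _ _).trans (add_le_add ?_ hts.le)
      refine (norm_integral_le_integral_norm _).trans (le_of_eq ?_)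
      refine integral_congr_ae (ae_restrict_of_ae ?_)
      filter_upwards [hvn] with ξ hξ
      rw [norm_mul, norm_chr, one_mul, hξ]
    have h3 := norm_sub_norm_le (∫ ξ, chr 0 ξ * v ξ ∂μ.tv) (∫ ξ, chr t ξ * v ξ ∂μ.tv)
    rw [norm_sub_rev] at h3
    linarith
  have hA : 0 < 1 + ∫ s, ‖k s‖ := by
    have : 0 ≤ ∫ s, ‖k s‖ := integral_nonneg fun _ => norm_nonneg _
    linarith
  refine le_of_forall_pos_le_add fun ε hε => ?_
  have := main (ε / (1 + ∫ s, ‖k s‖)) (by positivity)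
  rwa [div_mul_cancel₀ _ hA.ne'] at this

lemma l1_ineq (T : SchwartzMap E ℂ →L[ℂ] ℂ) (μ : CMeasure E) (hAg : μ.Agrees (fourierTD T))
    (f : SchwartzMap E ℂ) (hf : IsBohrAP (convTD T f)) (S : Set E) (hS : MeasurableSet S)
    (hat : ∀ x ∉ S, μ.tv {x} = 0) (φ : E → ℂ) (hφ : Integrable φ μ.tv) :
    ‖∫ ξ, φ ξ * 𝓕 f ξ * μ.density ξ ∂μ.tv‖ ≤ ∫ ξ in S, ‖φ ξ‖ * ‖𝓕 f ξ‖ ∂μ.tv := by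
  have := μ.locFin
  set C := SchwartzMap.seminorm ℂ 0 0 (𝓕 f : SchwartzMap E ℂ) with hC
  have hC0 : 0 ≤ C := apply_nonneg _ _
  have hfC : ∀ ξ, ‖𝓕 f ξ‖ ≤ C := (𝓕 f : SchwartzMap E ℂ).norm_le_seminorm ℂ
  have hfc : Continuous (fun ξ => 𝓕 f ξ) := (𝓕 f : SchwartzMap E ℂ).continuous
  have hI : ∀ w : E → ℂ, Integrable w μ.tv →
      Integrable (fun ξ => w ξ * 𝓕 f ξ * μ.density ξ) μ.tv := by
    intro w hw
    refine (hw.mul_bdd (c := C) hfc.aestronglyMeasurable (Eventually.of_forall hfC)).mul_bdd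
      (c := 1) μ.density_meas.aestronglyMeasurable ?_
    filter_upwards [μ.density_norm] with x hx using hx.le
  have hI' : ∀ w : E → ℂ, Integrable w μ.tv →
      Integrable (fun ξ => ‖w ξ‖ * ‖𝓕 f ξ‖) μ.tv := by
    intro w hw
    exact hw.norm.mul_bdd (c := C) hfc.norm.aestronglyMeasurable
      (Eventually.of_forall fun ξ => by simpa using hfC ξ)
  refine le_of_forall_pos_le_add fun ε hε => ?_
  set δ := ε / (2 * C + 1) with hδ
  have hδ0 : 0 < δ := by positivity
  obtain ⟨u0, huc, hus, hu⟩ := MeasureTheory.MemLp.exist_eLpNorm_sub_le (p := 1) (by simp)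
    le_rfl (memLp_one_iff_integrable.2 hφ) hδ0
  let u : SchwartzMap E ℂ := huc.toSchwartzMap hus
  have huu : ∀ ξ, u ξ = u0 ξ := fun _ => rfl
  have hui : Integrable u μ.tv := u.continuous.integrable_of_hasCompactSupport huc
  have hd : ∫ ξ, ‖φ ξ - u ξ‖ ∂μ.tv ≤ δ := by
    have e := integral_norm_eq_lintegral_enorm (hφ.sub hui).aestronglyMeasurable
    simp only [Pi.sub_apply] at e
    rw [e]
    rw [eLpNorm_one_eq_lintegral_enorm] at hu
    exact ENNReal.toReal_le_of_le_ofReal hδ0.le hu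
  have hdi : Integrable (fun ξ => φ ξ - u ξ) μ.tv := hφ.sub hui
  have h0 := test_ineq T μ hAg f hf S hS hat u huc
  have h1 : ‖(∫ ξ, φ ξ * 𝓕 f ξ * μ.density ξ ∂μ.tv) - ∫ ξ, u ξ * 𝓕 f ξ * μ.density ξ ∂μ.tv‖
      ≤ C * δ := by
    rw [← integral_sub (hI φ hφ) (hI u hui)]
    have : ‖∫ ξ, (φ ξ * 𝓕 f ξ * μ.density ξ - u ξ * 𝓕 f ξ * μ.density ξ) ∂μ.tv‖
        ≤ ∫ ξ, C * ‖φ ξ - u ξ‖ ∂μ.tv := by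
      refine norm_integral_le_of_norm_le (hdi.norm.const_mul C) ?_
      filter_upwards [μ.density_norm] with ξ hξ
      rw [← sub_mul, ← sub_mul, norm_mul, hξ, mul_one, norm_mul, mul_comm]
      gcongr
      exact hfC ξ
    rw [integral_const_mul] at this
    exact this.trans (by gcongr)
  have h2 : ∫ ξ in S, ‖u ξ‖ * ‖𝓕 f ξ‖ ∂μ.tv ≤ (∫ ξ in S, ‖φ ξ‖ * ‖𝓕 f ξ‖ ∂μ.tv) + C * δ := by
    have h3 : ∫ ξ in S, ‖u ξ‖ * ‖𝓕 f ξ‖ ∂μ.tv ≤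
        ∫ ξ in S, (‖φ ξ‖ * ‖𝓕 f ξ‖ + C * ‖φ ξ - u ξ‖) ∂μ.tv := by
      refine integral_mono (hI' u hui).restrict
        ((hI' φ hφ).restrict.add (hdi.norm.const_mul C).restrict) fun ξ => ?_
      have e1 : ‖u ξ‖ ≤ ‖φ ξ‖ + ‖φ ξ - u ξ‖ := by
        have := norm_sub_norm_le (u ξ) (φ ξ)
        rw [norm_sub_rev] at this; linarith
      calc ‖u ξ‖ * ‖𝓕 f ξ‖ ≤ (‖φ ξ‖ + ‖φ ξ - u ξ‖) * ‖𝓕 f ξ‖ := by gcongr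
        _ = ‖φ ξ‖ * ‖𝓕 f ξ‖ + ‖𝓕 f ξ‖ * ‖φ ξ - u ξ‖ := by ring
        _ ≤ _ := by gcongr; exact hfC ξ
    rw [integral_add (hI' φ hφ).restrict (hdi.norm.const_mul C).restrict, integral_const_mul] at h3
    have h4 : ∫ ξ in S, ‖φ ξ - u ξ‖ ∂μ.tv ≤ δ :=
      (setIntegral_le_integral hdi.norm (Eventually.of_forall fun _ => norm_nonneg _)).trans hd
    exact h3.trans (by gcongr)
  have h5 := norm_sub_norm_le (∫ ξ, φ ξ * 𝓕 f ξ * μ.density ξ ∂μ.tv)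
    (∫ ξ, u ξ * 𝓕 f ξ * μ.density ξ ∂μ.tv)
  have h6 : (2 * C + 1) * δ = ε := by rw [hδ]; field_simp
  nlinarith

lemma purePoint_aux (T : SchwartzMap E ℂ →L[ℂ] ℂ) (μ : CMeasure E) (hAg : μ.Agrees (fourierTD T))
    (f : SchwartzMap E ℂ) (hf : IsBohrAP (convTD T f))
    (hzero : {ξ : E | 𝓕 f ξ = 0}.Countable) : μ.IsPurePoint := by
  have := μ.locFin
  have hatoms : {x : E | 0 < μ.tv {x}}.Countable :=
    Measure.countable_meas_pos_of_disjoint_iUnion (μ := μ.tv) (As := fun x : E => ({x} : Set E))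
      (fun x => measurableSet_singleton x) (fun x y hxy => by simpa using hxy)
  set S := {x : E | 0 < μ.tv {x}} ∪ {ξ : E | 𝓕 f ξ = 0} with hSdef
  have hSc : S.Countable := hatoms.union hzero
  have hS : MeasurableSet S := hSc.measurableSet
  have hat : ∀ x ∉ S, μ.tv {x} = 0 := by
    intro x hx
    by_contra h
    exact hx (Or.inl (pos_iff_ne_zero.2 h))
  refine ⟨S, hSc, ?_⟩
  have hfc : Continuous (fun ξ => 𝓕 f ξ) := (𝓕 f : SchwartzMap E ℂ).continuous
  have hR : ∀ n : ℕ, μ.tv (Sᶜ ∩ closedBall 0 n) = 0 := by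
    intro n
    set A := Sᶜ ∩ closedBall (0 : E) n with hA
    have hAm : MeasurableSet A := hS.compl.inter measurableSet_closedBall
    set φ : E → ℂ := A.indicator (fun ξ => conj (𝓕 f ξ * μ.density ξ)) with hφdef
    have hφ : Integrable φ μ.tv := by
      rw [hφdef, integrable_indicator_iff hAm]
      have h1 : IntegrableOn (fun ξ => conj (𝓕 f ξ)) (closedBall (0:E) n) μ.tv :=
        (Complex.continuous_conj.comp hfc).continuousOn.integrableOn_compact
          (isCompact_closedBall _ _)
      have h2 : Integrable (fun ξ => conj (𝓕 f ξ) * conj (μ.density ξ)) (μ.tv.restrict A) := by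
        refine (h1.mono_set Set.inter_subset_right).mul_bdd (c := 1)
          (Complex.continuous_conj.measurable.comp μ.density_meas).aestronglyMeasurable ?_
        filter_upwards [ae_restrict_of_ae μ.density_norm] with x hx
        simp [hx]
      exact h2.congr (Eventually.of_forall fun ξ => (map_mul _ _ _).symm)
    have h := l1_ineq T μ hAg f hf S hS hat φ hφ
    have hz : ∫ ξ in S, ‖φ ξ‖ * ‖𝓕 f ξ‖ ∂μ.tv = 0 := by
      rw [setIntegral_congr_fun hS (g := fun _ => (0:ℝ)), integral_zero]
      intro ξ hξ
      have : ξ ∉ A := fun h => h.1 hξ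
      simp [hφdef, this]
    rw [hz] at h
    have h0 : ∫ ξ, φ ξ * 𝓕 f ξ * μ.density ξ ∂μ.tv = 0 := norm_le_zero_iff.1 h
    have h1 : ∫ ξ, φ ξ * 𝓕 f ξ * μ.density ξ ∂μ.tv =
        ((∫ ξ in A, ‖𝓕 f ξ‖ ^ 2 ∂μ.tv : ℝ) : ℂ) := by
      rw [← integral_complex_ofReal, ← integral_indicator hAm]
      refine integral_congr_ae ?_
      filter_upwards [μ.density_norm] with ξ hξ
      by_cases hx : ξ ∈ A
      · simp only [hφdef, Set.indicator_of_mem hx]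
        rw [mul_assoc, mul_comm, Complex.mul_conj, Complex.normSq_eq_norm_sq, norm_mul, hξ, mul_one]
      · simp [hφdef, Set.indicator_of_notMem hx]
    rw [h1] at h0
    have h2 : ∫ ξ in A, ‖𝓕 f ξ‖ ^ 2 ∂μ.tv = 0 := by exact_mod_cast h0
    have hi : IntegrableOn (fun ξ => ‖𝓕 f ξ‖ ^ 2) A μ.tv :=
      ((hfc.norm.pow 2).continuousOn.integrableOn_compact
        (isCompact_closedBall (0:E) n)).mono_set Set.inter_subset_right
    rw [setIntegral_eq_zero_iff_of_nonneg_ae (Eventually.of_forall fun _ => by positivity) hi] at h2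
    have h3 : ∀ᵐ ξ ∂(μ.tv.restrict A), False := by
      filter_upwards [h2, ae_restrict_mem hAm] with ξ e1 e2
      have e3 : 𝓕 f ξ = 0 := by simpa using e1
      exact e2.1 (Or.inr e3)
    have h4 : μ.tv.restrict A = 0 := by
      rwa [eventually_false_iff_eq_bot, ae_eq_bot] at h3
    exact Measure.restrict_eq_zero.1 h4
  have hU : Sᶜ = ⋃ n : ℕ, Sᶜ ∩ closedBall (0:E) n := by
    rw [← Set.inter_iUnion, iUnion_closedBall_nat, Set.inter_univ]
  rw [hU]
  exact measure_iUnion_null hR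

end Pieces4

/-- If `T̂` agrees with a tempered measure `μ`, `T*f` is Bohr almost
periodic for some Schwartz `f`, and the zero set of `f̂` is at most countable, then `μ`
is a pure-point measure. -/
theorem purePoint_of_conv_sap (d : ℕ)
    (T : SchwartzMap (EuclideanSpace ℝ (Fin d)) ℂ →L[ℂ] ℂ)
    (μ : CMeasure (EuclideanSpace ℝ (Fin d)))
    (hAg : μ.Agrees (fourierTD T))
    (f : SchwartzMap (EuclideanSpace ℝ (Fin d)) ℂ)
    (hf : IsBohrAP (convTD T f))
    (hzero : {ξ : EuclideanSpace ℝ (Fin d) | SchwartzMap.fourierTransformCLM ℂ f ξ = 0}.Countable) :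
    μ.IsPurePoint := by
  exact purePoint_aux T μ hAg f hf hzero
end
end
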